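/- arXiv:1607.07069 — 2 statements merged into one kernel-verified Lean document; each statement's English description precedes it below -/
import Mathlib

section
/- Let ω: ℕ → ℝ be any function with ω(n) → ∞, and let Y = Y(n,p) be the random 2-complex. If p ≥ (2 log n + ω(n))/n, then w.h.p. H₁(Y, ℤ/2ℤ) = 0; and if p ≤ (2 log n − ω(n))/n, then w.h.p. H₁(Y, ℤ/2ℤ) ≠ 0. -/
open MeasureTheory Filter Finset Matrix

noncomputable section

/-- Bernoulli measure on `Bool` with success probability `p` (clamped to `[0,1]`). -/
def bernoulliBool (p : ℝ) : Measure Bool :=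
  ENNReal.ofReal (max 0 (min p 1)) • Measure.dirac true +
    ENNReal.ofReal (1 - max 0 (min p 1)) • Measure.dirac false

instance (p : ℝ) : IsFiniteMeasure (bernoulliBool p) := by
  constructor
  simp only [bernoulliBool, Measure.add_apply, Measure.smul_apply, smul_eq_mul,
    measure_univ, mul_one]
  exact ENNReal.add_lt_top.mpr ⟨ENNReal.ofReal_lt_top, ENNReal.ofReal_lt_top⟩

/-- Index type for potential `d`-dimensional faces on vertex set `Fin n`:
the `(d+1)`-element subsets. -/
abbrev FaceIdx (n d : ℕ) : Type := {s : Finset (Fin n) // s.card = d + 1}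

/-- The distribution of the random `d`-complex `Y_d(n,p)`: each potential `d`-face
gets an independent Bernoulli(`p`) coin. (For `d = 1` this is the Erdős–Rényi model
`G(n,p)`.) -/
def YMeasure (n d : ℕ) (p : ℝ) : Measure (FaceIdx n d → Bool) :=
  Measure.pi fun _ => bernoulliBool p

/-- The random `d`-complex: all faces of dimension `≤ d - 1` (i.e. all subsets of
cardinality `≤ d`, including `∅`, so that degree-0 homology below is reduced
homology), together with the chosen `d`-faces. -/
def Ycomplex (n d : ℕ) (ω : FaceIdx n d → Bool) : Finset (Finset (Fin n)) :=
  Finset.univ.filter fun s => s.card ≤ d ∨ ∃ h : s.card = d + 1, ω ⟨s, h⟩ = true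

/-- The Erdős–Rényi random graph associated to a configuration of edge coins. -/
def graphOf (n : ℕ) (ω : FaceIdx n 1 → Bool) : SimpleGraph (Fin n) where
  Adj i j := i ≠ j ∧ ∃ e : FaceIdx n 1, ω e = true ∧ i ∈ e.1 ∧ j ∈ e.1
  symm := ⟨fun i j ⟨hne, e, he, hi, hj⟩ => ⟨hne.symm, e, he, hj, hi⟩⟩
  loopless := ⟨fun i ⟨hne, _⟩ => hne rfl⟩

instance (n : ℕ) (ω : FaceIdx n 1 → Bool) : DecidableRel (graphOf n ω).Adj :=
  fun i j =>
    inferInstanceAs (Decidable (i ≠ j ∧ ∃ e : FaceIdx n 1, ω e = true ∧ i ∈ e.1 ∧ j ∈ e.1))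

/-- The clique complex of the graph determined by the edge coins `ω`:
faces are vertex sets of complete subgraphs (including `∅` and singletons). -/
def cliqueComplex (n : ℕ) (ω : FaceIdx n 1 → Bool) : Finset (Finset (Fin n)) :=
  Finset.univ.filter fun s => ∀ i ∈ s, ∀ j ∈ s, i ≠ j → (graphOf n ω).Adj i j

/-- The group of simplicial `G`-chains of a complex `K`, in cardinality `c`
(i.e. dimension `c - 1`): functions on the faces of `K` of cardinality `c`. -/
abbrev Chains {V : Type} [Fintype V] [DecidableEq V]
    (K : Finset (Finset V)) (c : ℕ) (G : Type) : Type :=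
  {s : Finset V // s ∈ K ∧ s.card = c} → G

/-- The simplicial boundary map, from chains of cardinality `c+1` to chains of
cardinality `c`, with the usual alternating signs coming from the linear order
on the vertices. -/
def chainBoundary {V : Type} [Fintype V] [DecidableEq V] [LinearOrder V]
    (K : Finset (Finset V)) (c : ℕ) {G : Type} [AddCommGroup G]
    (f : Chains K (c + 1) G) : Chains K c G :=
  fun τ => ∑ v : V,
    if h : v ∉ τ.1 ∧ insert v τ.1 ∈ K then
      ((-1 : ℤ) ^ (τ.1.filter (fun u => u < v)).card) •
        f ⟨insert v τ.1, h.2, by rw [Finset.card_insert_of_notMem h.1, τ.2.2]⟩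
    else 0

/-- Vanishing of the simplicial homology of `K` with coefficients in `G` in
degree `i` (faces of cardinality `i+1`): every cycle is a boundary.
If `∅ ∈ K` this is reduced homology (the boundary map to cardinality-0 chains
is the augmentation); in degrees `i ≥ 1` reduced and unreduced homology agree. -/
def HomologyZero {V : Type} [Fintype V] [DecidableEq V] [LinearOrder V]
    (K : Finset (Finset V)) (i : ℕ) (G : Type) [AddCommGroup G] : Prop :=
  ∀ f : Chains K (i + 1) G, chainBoundary K i f = 0 →
    ∃ g : Chains K (i + 2) G, chainBoundary K (i + 1) g = f

/-- Vanishing of top-dimensional homology `H_d(K,G)`, i.e. the kernel of the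
`d`-th boundary map is zero. -/
def TopHomologyZero {V : Type} [Fintype V] [DecidableEq V] [LinearOrder V]
    (K : Finset (Finset V)) (d : ℕ) (G : Type) [AddCommGroup G] : Prop :=
  ∀ f : Chains K (d + 1) G, chainBoundary K d f = 0 → f = 0

/-- The boundary map on real coefficients, as a linear map. -/
def chainBoundaryLin {V : Type} [Fintype V] [DecidableEq V] [LinearOrder V]
    (K : Finset (Finset V)) (c : ℕ) : Chains K (c + 1) ℝ →ₗ[ℝ] Chains K c ℝ where
  toFun := chainBoundary K c
  map_add' f g := by
    funext τ
    simp only [chainBoundary, Pi.add_apply]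
    rw [← Finset.sum_add_distrib]
    refine Finset.sum_congr rfl fun v _ => ?_
    split
    · simp [smul_add]
    · simp
  map_smul' r f := by
    funext τ
    simp only [chainBoundary, Pi.smul_apply, RingHom.id_apply]
    rw [Finset.smul_sum]
    refine Finset.sum_congr rfl fun v _ => ?_
    split
    · exact smul_comm _ _ _
    · simp

/-- The `k`-th Betti number of `K`: the dimension of the `k`-th real simplicial
homology, i.e. of (kernel of `∂_k`) / (image of `∂_{k+1}`). -/
def bettiNumber {V : Type} [Fintype V] [DecidableEq V] [LinearOrder V]
    (K : Finset (Finset V)) (k : ℕ) : ℕ :=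
  Module.finrank ℝ
    (↥(LinearMap.ker (chainBoundaryLin K k)) ⧸
      (LinearMap.range (chainBoundaryLin K (k + 1))).comap
        (LinearMap.ker (chainBoundaryLin K k)).subtype)

/-- The link of a face `σ` in the complex `K`. -/
def linkSet {V : Type} [Fintype V] [DecidableEq V]
    (K : Finset (Finset V)) (σ : Finset V) : Finset (Finset V) :=
  Finset.univ.filter fun τ => τ ∩ σ = ∅ ∧ τ ∪ σ ∈ K

/-- The graph underlying the link of a face `σ`: its vertices are the vertices
of the link, joined when they span an edge of the link. -/
def linkGraph {V : Type} [Fintype V] [DecidableEq V]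
    (K : Finset (Finset V)) (σ : Finset V) :
    SimpleGraph {v : V // {v} ∈ linkSet K σ} where
  Adj a b := a ≠ b ∧ ({a.1, b.1} : Finset V) ∈ linkSet K σ
  symm := ⟨fun a b ⟨hab, h⟩ => ⟨hab.symm, by rwa [Finset.pair_comm]⟩⟩
  loopless := ⟨fun a ⟨hab, _⟩ => hab rfl⟩

instance {V : Type} [Fintype V] [DecidableEq V] (K : Finset (Finset V)) (σ : Finset V) :
    DecidableRel (linkGraph K σ).Adj :=
  fun a b => inferInstanceAs (Decidable (a ≠ b ∧ ({a.1, b.1} : Finset V) ∈ linkSet K σ))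

/-- The normalized Laplacian `I - D^{-1/2} A D^{-1/2}` of a finite graph. -/
def normalizedLaplacian {W : Type} [Fintype W] [DecidableEq W]
    (H : SimpleGraph W) [DecidableRel H.Adj] : Matrix W W ℝ :=
  Matrix.of fun a b =>
    (if a = b then (1 : ℝ) else 0) -
      (if H.Adj a b then 1 / Real.sqrt ((H.degree a : ℝ) * (H.degree b : ℝ)) else 0)

/-- An elementary `d`-collapse step: remove a free `(d-1)`-face `σ` together with
the unique `d`-face `τ` containing it. -/
def CollapseStep {V : Type} [DecidableEq V] (d : ℕ) (K K' : Finset (Finset V)) : Prop :=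
  ∃ σ τ : Finset V, σ ∈ K ∧ τ ∈ K ∧ τ.card = d + 1 ∧ σ ⊆ τ ∧ σ.card = d ∧
    (∀ ρ ∈ K, σ ⊆ ρ → ρ.card = d + 1 → ρ = τ) ∧ K' = K \ {σ, τ}

/-- `K` is `d`-collapsible if some finite sequence of elementary collapses reduces it
to a complex of dimension at most `d-1`. -/
def IsDCollapsible {V : Type} [DecidableEq V] (d : ℕ) (K : Finset (Finset V)) : Prop :=
  ∃ K' : Finset (Finset V),
    Relation.ReflTransGen (CollapseStep d) K K' ∧ ∀ s ∈ K', s.card ≤ d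

/-- The geometric realization of a complex on vertex set `Fin n`, inside `ℝ^n`:
the union over the faces of the convex hulls of the corresponding standard
basis vectors. -/
def geomReal (n : ℕ) (K : Finset (Finset (Fin n))) : Set (Fin n → ℝ) :=
  ⋃ σ ∈ K, convexHull ℝ ((fun i => (Pi.single i 1 : Fin n → ℝ)) '' ↑σ)

/-- The boundary of the simplex on the vertex set `τ`, as a chain of cardinality
`c` (to be used with `τ.card = c + 1`): the alternating sum of the `c`-element
subsets of `τ`. -/
def simplexBoundaryChain {V : Type} [Fintype V] [DecidableEq V] [LinearOrder V]
    (K : Finset (Finset V)) (c : ℕ) (τ : Finset V) : Chains K c ℝ :=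
  fun σ => ∑ v ∈ τ,
    if σ.1 = τ.erase v then ((-1 : ℝ) ^ (τ.filter (fun u => u < v)).card) else 0

/-- Index type for the multiparameter model: all potential faces of dimension `≥ 1`. -/
abbrev MultiIdx (n : ℕ) : Type := {s : Finset (Fin n) // 2 ≤ s.card}

/-- The distribution of the multiparameter random complex `X(n; p₁, p₂, …)`:
a potential face of cardinality `i+1` gets an independent Bernoulli(`p i`) coin. -/
def multiMeasure (n : ℕ) (p : ℕ → ℝ) : Measure (MultiIdx n → Bool) :=
  Measure.pi fun t => bernoulliBool (p (t.1.card - 1))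

/-- The multiparameter random complex: a set `s` is a face iff every subset of `s`
of dimension `≥ 1` has its coin turned on (this is exactly the
inductive-by-dimension construction: a face is present iff its coin is on and all
of its boundary faces are present). -/
def multiComplex (n : ℕ) (ω : MultiIdx n → Bool) : Finset (Finset (Fin n)) :=
  Finset.univ.filter fun s => ∀ t : MultiIdx n, t.1 ⊆ s → ω t = true

/-- The Vietoris–Rips complex of the points `pts` at scale `r`. -/
def VRcomplex (n d : ℕ) (pts : Fin n → EuclideanSpace ℝ (Fin d)) (r : ℝ) :
    Finset (Finset (Fin n)) :=
  Finset.univ.filter fun s => ∀ i ∈ s, ∀ j ∈ s, dist (pts i) (pts j) ≤ r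

end


namespace LM
variable {n : ℕ}

abbrev E (n : ℕ) : Finset (Finset (Fin n)) := powersetCard 2 univ
abbrev T (n : ℕ) : Finset (Finset (Fin n)) := powersetCard 3 univ
def dl (f : Finset (Fin n) → ZMod 2) (t : Finset (Fin n)) : ZMod 2 := ∑ e ∈ powersetCard 2 t, f e
def ind (G : Finset (Finset (Fin n))) (e : Finset (Fin n)) : ZMod 2 := if e ∈ G then 1 else 0
def Bad (G : Finset (Finset (Fin n))) : Finset (Finset (Fin n)) :=
  (T n).filter (fun t => dl (ind G) t ≠ 0)
def cb (ψ : Fin n → ZMod 2) (e : Finset (Fin n)) : ZMod 2 := ∑ u ∈ e, ψ u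
def supp (f : Finset (Fin n) → ZMod 2) : Finset (Finset (Fin n)) := (E n).filter (fun e => f e ≠ 0)
def Minim (G : Finset (Finset (Fin n))) : Prop :=
  ∀ ψ : Fin n → ZMod 2, #G ≤ #(supp (fun e => ind G e + cb ψ e))
def deg (G : Finset (Finset (Fin n))) (v : Fin n) : ℕ := #(G.filter (fun e => v ∈ e))

lemma zsmul_two (k : ℕ) (x : ZMod 2) : ((-1 : ℤ) ^ k) • x = x := by
  rcases neg_one_pow_eq_or ℤ k with h | h <;> rw [h] <;> simp

lemma zmod2_ne {x : ZMod 2} (h : x ≠ 0) : x = 1 := by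
  revert h; revert x; decide

lemma ind_supp (f : Finset (Fin n) → ZMod 2) {e : Finset (Fin n)} (he : e ∈ E n) :
    ind (supp f) e = f e := by
  unfold ind supp
  by_cases h : f e = 0
  · simp [h]
  · simp only [mem_filter]; rw [if_pos ⟨he, h⟩, zmod2_ne h]

lemma dl_three (f : Finset (Fin n) → ZMod 2) {a b c : Fin n} (hab : a ≠ b) (hac : a ≠ c) (hbc : b ≠ c) :
    dl f {a, b, c} = f {a, b} + (f {a, c} + f {b, c}) := by
  have : powersetCard 2 ({a, b, c} : Finset (Fin n)) = {{a, b}, {a, c}, {b, c}} := by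
    ext e
    simp only [mem_powersetCard, mem_insert, mem_singleton]
    constructor
    · rintro ⟨h1, h2⟩
      obtain ⟨x, y, hxy, rfl⟩ := card_eq_two.1 h2
      have hx := h1 (mem_insert_self x _)
      have hy := h1 (mem_insert_of_mem (mem_singleton_self y))
      simp only [mem_insert, mem_singleton] at hx hy
      rcases hx with rfl | rfl | rfl <;> rcases hy with rfl | rfl | rfl <;>
        simp_all [Finset.pair_comm]
    · rintro (rfl | rfl | rfl) <;> simp [*, Finset.subset_iff]
  unfold dl
  have h1 : ({a, b} : Finset (Fin n)) ∉ ({{a, c}, {b, c}} : Finset (Finset (Fin n))) := by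
    simp only [mem_insert, mem_singleton, not_or]
    constructor
    · intro h
      have : b ∈ ({a, c} : Finset (Fin n)) := h ▸ (by simp)
      simp at this; tauto
    · intro h
      have : a ∈ ({b, c} : Finset (Fin n)) := h ▸ (by simp)
      simp at this; tauto
  have h2 : ({a, c} : Finset (Fin n)) ∉ ({{b, c}} : Finset (Finset (Fin n))) := by
    simp only [mem_singleton]
    intro h
    have : a ∈ ({b, c} : Finset (Fin n)) := h ▸ (by simp)
    simp at this; tauto
  rw [this, sum_insert h1, sum_insert h2, sum_singleton]

lemma dl_cb (ψ : Fin n → ZMod 2) {t : Finset (Fin n)} (ht : #t = 3) : dl (cb ψ) t = 0 := by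
  obtain ⟨a, b, c, hab, hac, hbc, rfl⟩ := card_eq_three.1 ht
  rw [dl_three _ hab hac hbc]
  unfold cb
  rw [sum_pair hab, sum_pair hac, sum_pair hbc]
  generalize ψ a = x; generalize ψ b = y; generalize ψ c = z
  revert x y z; decide

/-- extension of a chain by zero -/
def ext {K : Finset (Finset (Fin n))} {c : ℕ} (f : Chains K c (ZMod 2)) (s : Finset (Fin n)) : ZMod 2 :=
  if h : s ∈ K ∧ #s = c then f ⟨s, h⟩ else 0

lemma chainB {K : Finset (Finset (Fin n))} {c : ℕ} (f : Chains K (c+1) (ZMod 2))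
    (τ : {s : Finset (Fin n) // s ∈ K ∧ #s = c}) :
    chainBoundary K c f τ = ∑ v, if v ∉ τ.1 then ext f (insert v τ.1) else 0 := by
  unfold chainBoundary
  refine sum_congr rfl fun v _ => ?_
  by_cases h1 : v ∉ τ.1
  · by_cases h2 : insert v τ.1 ∈ K
    · have h3 : #(insert v τ.1) = c + 1 := by rw [card_insert_of_notMem h1, τ.2.2]
      rw [dif_pos ⟨h1, h2⟩, if_pos h1, zsmul_two, ext, dif_pos ⟨h2, h3⟩]
    · rw [dif_neg (fun h => h2 h.2), if_pos h1, ext, dif_neg (fun h => h2 h.1)]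
  · rw [dif_neg (fun h => h1 h.1), if_neg h1]

def bd (K : Finset (Finset (Fin n))) (c : ℕ) :
    Chains K (c + 1) (ZMod 2) →ₗ[ZMod 2] Chains K c (ZMod 2) where
  toFun := chainBoundary K c
  map_add' f g := by
    funext τ
    simp only [chainBoundary, Pi.add_apply]
    rw [← Finset.sum_add_distrib]
    refine Finset.sum_congr rfl fun v _ => ?_
    split
    · simp [smul_add]
    · simp
  map_smul' r f := by
    funext τ
    simp only [chainBoundary, Pi.smul_apply, RingHom.id_apply]
    rw [Finset.smul_sum]
    refine Finset.sum_congr rfl fun v _ => ?_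
    split
    · exact smul_comm _ _ _
    · simp

lemma mem_K2 (ω : FaceIdx n 2 → Bool) {s : Finset (Fin n)} (h : #s ≤ 2) : s ∈ Ycomplex n 2 ω := by
  simp [Ycomplex, h]

lemma mem_K3 (ω : FaceIdx n 2 → Bool) {s : Finset (Fin n)} (h : #s = 3) :
    s ∈ Ycomplex n 2 ω ↔ ω ⟨s, h⟩ = true := by
  simp [Ycomplex, h]

lemma bd_single {K : Finset (Finset (Fin n))} (s : {s : Finset (Fin n) // s ∈ K ∧ #s = 3})
    (τ : {s : Finset (Fin n) // s ∈ K ∧ #s = 2}) :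
    chainBoundary K 2 (Pi.single s 1 : Chains K 3 (ZMod 2)) τ = if τ.1 ⊆ s.1 then 1 else 0 := by
  rw [chainB]
  have hx : ∀ r : Finset (Fin n), ext (Pi.single s 1 : Chains K 3 (ZMod 2)) r = if r = s.1 then 1 else 0 := by
    intro r
    unfold ext
    by_cases hr : r = s.1
    · subst hr
      rw [dif_pos s.2]; simp
    · rw [if_neg hr]
      split_ifs with h
      · rw [Pi.single_eq_of_ne]
        intro h'; apply hr; rw [← h']
      · rfl
  simp only [hx]
  split_ifs with h
  · obtain ⟨v, hv⟩ : ∃ v, s.1 \ τ.1 = {v} := by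
      rw [← card_eq_one, card_sdiff_of_subset h, s.2.2, τ.2.2]
    have hv' : v ∈ s.1 ∧ v ∉ τ.1 := by rw [← Finset.mem_sdiff, hv]; simp
    rw [sum_eq_single v]
    · rw [if_pos hv'.2, if_pos]
      apply eq_of_subset_of_card_le
      · exact insert_subset hv'.1 h
      · rw [card_insert_of_notMem hv'.2, s.2.2, τ.2.2]
    · intro b _ hb
      split_ifs with h1 h2
      · rfl
      · exfalso
        apply hb
        have : b ∈ s.1 \ τ.1 := by rw [Finset.mem_sdiff, ← h2]; simp [h1]
        rw [hv] at this; simpa using this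
      · rfl
    · simp
  · apply sum_eq_zero
    intro v _
    split_ifs with h1 h2
    · rfl
    · exact absurd (h2 ▸ subset_insert v τ.1) h
    · rfl

end LM

namespace LM
variable {n : ℕ}

lemma dl_congr {f g : Finset (Fin n) → ZMod 2} (h : ∀ e ∈ E n, f e = g e) (t : Finset (Fin n)) :
    dl f t = dl g t := by
  unfold dl
  refine sum_congr rfl fun e he => h e ?_
  rw [mem_powersetCard] at he ⊢
  exact ⟨subset_univ _, he.2⟩

lemma dl_add (f g : Finset (Fin n) → ZMod 2) (t : Finset (Fin n)) :
    dl (fun e => f e + g e) t = dl f t + dl g t := by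
  unfold dl; exact sum_add_distrib

lemma cb_add (f g : Fin n → ZMod 2) (t : Finset (Fin n)) :
    cb (fun e => f e + g e) t = cb f t + cb g t := by
  unfold cb; exact sum_add_distrib

lemma supp_congr {f g : Finset (Fin n) → ZMod 2} (h : ∀ e ∈ E n, f e = g e) :
    supp f = supp g := by
  unfold supp
  exact filter_congr fun e he => by rw [h e he]

lemma exists_cochain (ω : FaceIdx n 2 → Bool)
    (H : ¬ HomologyZero (Ycomplex n 2 ω) 1 (ZMod 2)) :
    ∃ f : Finset (Fin n) → ZMod 2,
      (∀ t (h : #t = 3), ω ⟨t, h⟩ = true → dl f t = 0) ∧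
      ∀ ψ : Fin n → ZMod 2, ∃ e ∈ E n, f e + cb ψ e ≠ 0 := by
  classical
  set K := Ycomplex n 2 ω with hK
  unfold HomologyZero at H
  push Not at H
  obtain ⟨z, hz, hz'⟩ := H
  have hnot : z ∉ LinearMap.range (bd K 2) := by
    rintro ⟨g, hg⟩
    exact hz' g hg
  obtain ⟨φ, hφ2, hφ1⟩ := Submodule.exists_le_ker_of_notMem hnot
  let f : Finset (Fin n) → ZMod 2 := fun e =>
    if h : e ∈ K ∧ #e = 2 then φ (Pi.single (⟨e, h⟩ : {s : Finset (Fin n) // s ∈ K ∧ #s = 2}) 1) else 0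
  have hrep : ∀ x : Chains K 2 (ZMod 2), φ x = ∑ e ∈ E n, ext x e * f e := by
    intro x
    have h1 : x = ∑ i, x i • (Pi.single i 1 : Chains K 2 (ZMod 2)) := by
      rw [pi_eq_sum_univ' x]
      simp [Pi.single_apply, funext_iff, eq_comm]
    have h2 : φ x = ∑ i : {s : Finset (Fin n) // s ∈ K ∧ #s = 2}, ext x i.1 * f i.1 := by
      conv_lhs => rw [h1, map_sum]
      refine sum_congr rfl fun i _ => ?_
      rw [map_smul, smul_eq_mul]
      simp only [ext, f]
      rw [dif_pos i.2, dif_pos i.2]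
    rw [h2]
    refine sum_bij (fun i _ => i.1) ?_ ?_ ?_ ?_
    · intro i _; rw [mem_powersetCard]; exact ⟨subset_univ _, i.2.2⟩
    · intro i _ j _ h; exact Subtype.ext h
    · intro e he
      rw [mem_powersetCard] at he
      exact ⟨⟨e, mem_K2 ω he.2.le, he.2⟩, mem_univ _, rfl⟩
    · intros; rfl
  refine ⟨f, ?_, ?_⟩
  · intro t h ht
    have htK : t ∈ K := (mem_K3 ω h).2 ht
    have h0 : φ (bd K 2 (Pi.single ⟨t, htK, h⟩ 1)) = 0 := by
      have := hφ1 (LinearMap.mem_range_self (bd K 2) (Pi.single ⟨t, htK, h⟩ 1))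
      simpa using this
    rw [hrep] at h0
    rw [← h0]
    unfold dl
    rw [← sum_filter_add_sum_filter_not (E n) (fun e => e ⊆ t)]
    have hA : (E n).filter (fun e => e ⊆ t) = powersetCard 2 t := by
      ext e; simp [mem_powersetCard, and_comm]
    rw [hA]
    have hv : ∀ e ∈ E n, ext (bd K 2 (Pi.single ⟨t, htK, h⟩ 1)) e = if e ⊆ t then 1 else 0 := by
      intro e he
      rw [mem_powersetCard] at he
      have : e ∈ K ∧ #e = 2 := ⟨mem_K2 ω he.2.le, he.2⟩
      rw [ext, dif_pos this]
      exact bd_single _ _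
    rw [sum_eq_zero (s := (E n).filter (fun e => ¬ e ⊆ t)), add_zero]
    · refine sum_congr rfl fun e he => ?_
      rw [← hA, mem_filter] at he
      rw [hv e he.1, if_pos he.2, one_mul]
    · intro e he
      rw [mem_filter] at he
      rw [hv e he.1, if_neg he.2, zero_mul]
  · intro ψ
    by_contra hcon
    push Not at hcon
    have hf : ∀ e ∈ E n, f e = cb ψ e := by
      intro e he
      have := hcon e he
      revert this
      generalize f e = x; generalize cb ψ e = y
      revert x y; decide
    apply hφ2
    rw [hrep]
    have e1 : ∑ e ∈ E n, ext z e * f e = ∑ e ∈ E n, ∑ u : Fin n, if u ∈ e then ext z e * ψ u else 0 := by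
      refine sum_congr rfl fun e he => ?_
      rw [hf e he, cb, mul_sum, sum_ite_mem, univ_inter]
    rw [e1, sum_comm]
    refine sum_eq_zero fun u _ => ?_
    have h1 : ({u} : Finset (Fin n)) ∈ K ∧ #({u} : Finset (Fin n)) = 1 := ⟨mem_K2 ω (by simp), by simp⟩
    have h2 := congrFun hz ⟨{u}, h1⟩
    rw [chainB] at h2
    simp only [Pi.zero_apply, mem_singleton] at h2
    rw [← sum_filter, ← sum_mul]
    have h3 : ∑ e ∈ (E n).filter (fun e => u ∈ e), ext z e = 0 := by
      rw [← h2, ← sum_filter]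
      symm
      refine sum_bij (fun v _ => insert v {u}) ?_ ?_ ?_ ?_
      · intro v hv
        rw [mem_filter] at hv
        simp only [mem_filter, mem_powersetCard, subset_univ, true_and]
        exact ⟨card_pair hv.2, by simp⟩
      · intro v hv v' hv' h
        rw [mem_filter] at hv
        have : v ∈ ({v', u} : Finset (Fin n)) := by rw [← h]; simp
        simp at this
        tauto
      · intro e he
        simp only [mem_filter, mem_powersetCard, subset_univ, true_and] at he
        obtain ⟨v, hv⟩ := card_eq_one.1 (show #(e.erase u) = 1 by rw [card_erase_of_mem he.2, he.1])
        refine ⟨v, ?_, ?_⟩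
        · have : v ∈ e.erase u := by rw [hv]; simp
          simp at this ⊢; exact this.1
        · rw [← insert_erase he.2, hv]; exact Finset.pair_comm _ _
      · intros; rfl
    rw [h3, zero_mul]

lemma exists_minim (ω : FaceIdx n 2 → Bool)
    (H : ¬ HomologyZero (Ycomplex n 2 ω) 1 (ZMod 2)) :
    ∃ G ⊆ E n, G.Nonempty ∧ Minim G ∧ ∀ t (h : #t = 3), t ∈ Bad G → ω ⟨t, h⟩ = false := by
  obtain ⟨f, h1, h2⟩ := exists_cochain ω H
  obtain ⟨ψ, -, hψ⟩ := exists_min_image (univ : Finset (Fin n → ZMod 2))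
    (fun ψ => #(supp (fun e => f e + cb ψ e))) univ_nonempty
  refine ⟨supp (fun e => f e + cb ψ e), filter_subset _ _, ?_, ?_, ?_⟩
  · obtain ⟨e, he, h⟩ := h2 ψ
    exact ⟨e, mem_filter.2 ⟨he, h⟩⟩
  · intro ψ'
    have := hψ (fun u => ψ u + ψ' u) (mem_univ _)
    refine this.trans (le_of_eq ?_)
    congr 1
    apply supp_congr
    intro e he
    rw [ind_supp _ he, cb_add, add_assoc]
  · intro t h ht
    by_contra hω
    rw [Bool.not_eq_false] at hω
    apply (mem_filter.1 ht).2
    rw [dl_congr (fun e he => ind_supp _ he), dl_add, h1 t h hω, dl_cb _ h, add_zero]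

end LM

namespace LM
variable {n : ℕ}

lemma memE {e : Finset (Fin n)} : e ∈ E n ↔ #e = 2 := by simp [E, mem_powersetCard]
lemma memT {e : Finset (Fin n)} : e ∈ T n ↔ #e = 3 := by simp [T, mem_powersetCard]

lemma sum_deg {G : Finset (Finset (Fin n))} (hG : G ⊆ E n) : ∑ v, deg G v = 2 * #G := by
  unfold deg
  simp_rw [card_filter]
  rw [sum_comm]
  rw [sum_congr rfl (g := fun _ => 2)]
  · simp [mul_comm]
  · intro e he
    rw [← card_filter]
    have := memE.1 (hG he)
    rw [← this]; congr 1; ext; simp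

lemma sum_deg_sq (G : Finset (Finset (Fin n))) :
    ∑ v, deg G v ^ 2 = ∑ e ∈ G, ∑ v ∈ e, deg G v := by
  have : ∀ e ∈ G, ∑ v ∈ e, deg G v = ∑ v, if v ∈ e then deg G v else 0 := by
    intro e _; rw [sum_ite_mem, univ_inter]
  rw [sum_congr rfl this, sum_comm]
  refine sum_congr rfl fun v _ => ?_
  rw [← sum_filter, sum_const, smul_eq_mul, sq, deg]

lemma sum_deg_sq' (G : Finset (Finset (Fin n))) :
    ∑ v, deg G v ^ 2 = ∑ e ∈ G, ∑ f ∈ G, #(e ∩ f) := by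
  rw [sum_deg_sq]
  refine sum_congr rfl fun e _ => ?_
  unfold deg
  simp_rw [card_filter]
  rw [sum_comm]
  refine sum_congr rfl fun f _ => ?_
  rw [← card_filter, filter_mem_eq_inter]

lemma card_T_sup {e : Finset (Fin n)} (he : #e = 2) : #((T n).filter (fun t => e ⊆ t)) + 2 = n := by
  have h : #((T n).filter (fun t => e ⊆ t)) = #(univ \ e) := by
    symm
    refine card_bij (fun v _ => insert v e) ?_ ?_ ?_
    · intro v hv
      rw [mem_filter, memT, card_insert_of_notMem (by simpa using hv), he]
      exact ⟨rfl, subset_insert _ _⟩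
    · intro v hv v' hv' h
      have : v ∈ insert v' e := by rw [← h]; simp
      simp at this hv
      tauto
    · intro t ht
      rw [mem_filter, memT] at ht
      obtain ⟨v, hv⟩ : ∃ v, t \ e = {v} := by
        rw [← card_eq_one, card_sdiff_of_subset ht.2, ht.1, he]
      have hv' : v ∈ t ∧ v ∉ e := by rw [← Finset.mem_sdiff, hv]; simp
      refine ⟨v, by simpa using hv'.2, ?_⟩
      apply eq_of_subset_of_card_le
      · exact insert_subset hv'.1 ht.2
      · rw [card_insert_of_notMem hv'.2, ht.1, he]
  rw [h, card_sdiff_of_subset (subset_univ _), he, card_univ, Fintype.card_fin]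
  have : #e ≤ n := by simpa using card_le_univ e
  omega

lemma card_T_two {e f : Finset (Fin n)} (he : #e = 2) (hf : #f = 2) (h : e ≠ f) :
    #((T n).filter (fun t => e ⊆ t ∧ f ⊆ t)) ≤ #(e ∩ f) := by
  have hu := card_union_add_card_inter e f
  have hi : #(e ∩ f) < 2 := by
    by_contra hc
    push Not at hc
    have h1 : e ∩ f = e := eq_of_subset_of_card_le inter_subset_left (by omega)
    have h2 : e ∩ f = f := eq_of_subset_of_card_le inter_subset_right (by omega)
    exact h (h1.symm.trans h2)
  have key : ∀ t ∈ (T n).filter (fun t => e ⊆ t ∧ f ⊆ t), t = e ∪ f ∧ #(e ∪ f) = 3 := by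
    intro t ht
    rw [mem_filter, memT] at ht
    have hs := union_subset ht.2.1 ht.2.2
    have := card_le_card hs
    have h3 : e ∪ f = t := eq_of_subset_of_card_le hs (by omega)
    exact ⟨h3.symm, by omega⟩
  by_cases h0 : #(e ∩ f) = 0
  · rw [h0, Nat.le_zero, card_eq_zero, eq_empty_iff_forall_notMem]
    intro t ht
    have := key t ht
    omega
  · have : #((T n).filter (fun t => e ⊆ t ∧ f ⊆ t)) ≤ 1 := by
      rw [card_le_one]
      intro a ha b hb
      rw [(key a ha).1, (key b hb).1]
    omega

lemma dl_ind {G : Finset (Finset (Fin n))} (hG : G ⊆ E n) (t : Finset (Fin n)) :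
    dl (ind G) t = ((#(G.filter (fun e => e ⊆ t)) : ℕ) : ZMod 2) := by
  unfold dl ind
  rw [sum_boole]
  congr 2
  ext e
  simp only [mem_filter, mem_powersetCard]
  constructor
  · rintro ⟨h1, h2⟩; exact ⟨h2, h1.1⟩
  · rintro ⟨h1, h2⟩; exact ⟨⟨h2, memE.1 (hG h1)⟩, h1⟩

lemma bad_lower {G : Finset (Finset (Fin n))} (hG : G ⊆ E n) :
    #G * n ≤ #(Bad G) + ∑ v, deg G v ^ 2 := by
  set c : Finset (Fin n) → ℕ := fun t => #(G.filter (fun e => e ⊆ t)) with hc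
  have h1 : (∑ t ∈ T n, (2 * (c t : ℤ) - (c t : ℤ) ^ 2)) ≤ ((#(Bad G) : ℕ) : ℤ) := by
    unfold Bad
    rw [card_filter]
    push_cast
    refine sum_le_sum fun t _ => ?_
    split_ifs with h
    · nlinarith [sq_nonneg ((c t : ℤ) - 1)]
    · rw [dl_ind hG, ne_eq, not_not, ZMod.natCast_eq_zero_iff_even] at h
      change Even (c t) at h
      rcases h with ⟨r, hr⟩
      rw [hr]; push_cast
      rcases Nat.eq_zero_or_pos r with h0 | h0
      · subst h0; simp
      · have : (1 : ℤ) ≤ r := by exact_mod_cast h0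
        nlinarith
  have h2 : ∑ t ∈ T n, (c t : ℤ) = #G * ((n : ℤ) - 2) := by
    simp only [hc, card_filter]
    push_cast
    rw [sum_comm, sum_congr rfl (g := fun _ => (n : ℤ) - 2)]
    · rw [sum_const, nsmul_eq_mul]
    · intro e he
      have := card_T_sup (memE.1 (hG he))
      rw [card_filter] at this
      zify at this
      linarith
  have h3 : ∑ t ∈ T n, (c t : ℤ) ^ 2 = ∑ e ∈ G, ∑ f ∈ G, (#((T n).filter (fun t => e ⊆ t ∧ f ⊆ t)) : ℤ) := by
    simp only [hc, card_filter]
    push_cast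
    simp_rw [sq, sum_mul_sum]
    rw [sum_comm]
    refine sum_congr rfl fun e _ => ?_
    rw [sum_comm]
    refine sum_congr rfl fun f _ => sum_congr rfl fun t _ => ?_
    by_cases h1 : e ⊆ t <;> by_cases h2 : f ⊆ t <;> simp [h1, h2]
  have h4 : ∑ e ∈ G, ∑ f ∈ G, (#((T n).filter (fun t => e ⊆ t ∧ f ⊆ t)) : ℤ) ≤
      ∑ e ∈ G, ∑ f ∈ G, ((#(e ∩ f) : ℤ) + if e = f then (n : ℤ) - 4 else 0) := by
    refine sum_le_sum fun e he => sum_le_sum fun f hf => ?_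
    split_ifs with h
    · subst h
      have := card_T_sup (memE.1 (hG he))
      simp only [and_self, inter_self]
      rw [memE.1 (hG he)]
      zify at this
      push_cast
      linarith
    · have := card_T_two (memE.1 (hG he)) (memE.1 (hG hf)) h
      zify at this
      linarith
  have h5 : ∑ e ∈ G, ∑ f ∈ G, ((#(e ∩ f) : ℤ) + if e = f then (n : ℤ) - 4 else 0) =
      ((∑ v, deg G v ^ 2 : ℕ) : ℤ) + #G * ((n : ℤ) - 4) := by
    rw [sum_deg_sq']
    push_cast
    simp_rw [sum_add_distrib]
    congr 1
    rw [sum_congr rfl (g := fun _ => (n : ℤ) - 4)]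
    · rw [sum_const, nsmul_eq_mul]
    · intro e he; simp [he]
  rw [sum_sub_distrib, ← mul_sum, h2, h3] at h1
  zify
  push_cast at h5
  nlinarith

lemma deg_E (v : Fin n) : deg (E n) v ≤ n := by
  have : (E n).filter (fun e => v ∈ e) ⊆ univ.image (fun u => ({u, v} : Finset (Fin n))) := by
    intro e he
    rw [mem_filter, memE] at he
    obtain ⟨a, b, hab, rfl⟩ := card_eq_two.1 he.1
    have h := he.2
    simp only [mem_insert, mem_singleton] at h
    rw [mem_image]
    rcases h with rfl | rfl
    · exact ⟨b, mem_univ _, Finset.pair_comm _ _⟩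
    · exact ⟨a, mem_univ _, rfl⟩
  calc deg (E n) v ≤ _ := card_le_card this
    _ ≤ _ := card_image_le
    _ = n := by simp

lemma deg_half {G : Finset (Finset (Fin n))} (hG : G ⊆ E n) (hM : Minim G) (v : Fin n) :
    2 * deg G v ≤ n := by
  have h := hM (Pi.single v 1)
  have h1 : supp (fun e => ind G e + cb (Pi.single v 1) e) ⊆
      G.filter (fun e => v ∉ e) ∪ ((E n).filter (fun e => v ∈ e) \ G.filter (fun e => v ∈ e)) := by
    intro e he
    unfold supp at he
    rw [mem_filter] at he
    have hcb : cb (Pi.single v 1) e = if v ∈ e then 1 else 0 := by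
      unfold cb; simp [Pi.single_apply]
    beta_reduce at he
    rw [hcb] at he
    simp only [mem_union, mem_filter, Finset.mem_sdiff]
    by_cases hv : v ∈ e <;> by_cases hg : e ∈ G <;> simp_all [ind]
    exact he.2 (by decide)
  have h2 := card_le_card h1
  have h3 := card_union_le (G.filter (fun e => v ∉ e)) ((E n).filter (fun e => v ∈ e) \ G.filter (fun e => v ∈ e))
  rw [card_sdiff_of_subset (filter_subset_filter _ hG)] at h3
  have h4 := card_filter_add_card_filter_not (s := G) (fun e => v ∈ e)
  have h5 := deg_E v
  unfold deg at h5 ⊢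
  have h6 := card_le_card (filter_subset_filter (fun e => v ∈ e) hG)
  omega

lemma bad_third {G : Finset (Finset (Fin n))} (hG : G ⊆ E n) (hM : Minim G) :
    n * #G ≤ 3 * #(Bad G) := by
  have key : ∀ v : Fin n, #G ≤ #((Bad G).filter (fun t => v ∈ t)) := by
    intro v
    set ψ : Fin n → ZMod 2 := fun u => ind G {u, v} with hψ
    have hvv : ψ v = 0 := by
      simp only [hψ, ind]
      rw [if_neg]
      intro h
      have := memE.1 (hG h)
      simp at this
    refine (hM ψ).trans ?_
    have hnv : ∀ e ∈ supp (fun e => ind G e + cb ψ e), v ∉ e := by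
      intro e he hv
      unfold supp at he
      rw [mem_filter, memE] at he
      obtain ⟨he1, he2⟩ := he
      apply he2
      obtain ⟨u, hu⟩ := card_eq_one.1 (show #(e.erase v) = 1 by rw [card_erase_of_mem hv, he1])
      have huv : u ≠ v := by
        have : u ∈ e.erase v := by rw [hu]; simp
        simp at this; exact this.1
      have hE : e = {u, v} := by rw [← insert_erase hv, hu]; exact Finset.pair_comm _ _
      subst hE
      unfold cb
      beta_reduce
      rw [sum_pair huv, hvv, add_zero]
      exact CharTwo.add_self_eq_zero _
    refine card_le_card_of_injOn (fun e => insert v e) ?_ ?_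
    · intro e he
      have hv := hnv e he
      simp only [coe_filter, Set.mem_setOf_eq, mem_insert_self, and_true]
      have he' : e ∈ supp (fun e => ind G e + cb ψ e) := he
      unfold supp at he'
      rw [mem_filter, memE] at he'
      obtain ⟨a, b, hab, rfl⟩ := card_eq_two.1 he'.1
      simp only [mem_insert, mem_singleton, not_or] at hv
      unfold Bad
      rw [mem_filter, memT]
      refine ⟨card_eq_three.2 ⟨v, a, b, hv.1, hv.2, hab, rfl⟩, ?_⟩
      rw [dl_three _ hv.1 hv.2 hab]
      intro h0
      apply he'.2
      unfold cb
      beta_reduce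
      rw [sum_pair hab, ← h0]
      simp only [hψ]
      rw [Finset.pair_comm a v, Finset.pair_comm b v]
      ring
    · intro e he f hf h
      have h1 := hnv e he
      have h2 := hnv f hf
      have := congrArg (fun s => s.erase v) h
      simpa [erase_insert h1, erase_insert h2] using this
  have h1 : ∑ _v : Fin n, #G ≤ ∑ v : Fin n, #((Bad G).filter (fun t => v ∈ t)) :=
    sum_le_sum fun v _ => key v
  have h2 : ∑ v : Fin n, #((Bad G).filter (fun t => v ∈ t)) = 3 * #(Bad G) := by
    simp_rw [card_filter]
    rw [sum_comm, sum_congr rfl (g := fun _ => 3)]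
    · simp [mul_comm]
    · intro e he
      rw [← card_filter]
      have := memT.1 (mem_filter.1 he).1
      rw [← this]; congr 1; ext; simp
  simpa [h2] using h1

def DD (G : Finset (Finset (Fin n))) : Finset (Fin n) := univ.filter (fun v => n ≤ 8 * deg G v)

lemma card_DD {G : Finset (Finset (Fin n))} (hG : G ⊆ E n) : #(DD G) * n ≤ 16 * #G := by
  have h := sum_deg hG
  have h1 : ∑ v ∈ DD G, n ≤ ∑ v ∈ DD G, 8 * deg G v := sum_le_sum fun v hv => (mem_filter.1 hv).2
  have h2 : ∑ v ∈ DD G, 8 * deg G v ≤ ∑ v, 8 * deg G v :=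
    sum_le_sum_of_subset (subset_univ _)
  rw [← mul_sum, ← mul_sum, h] at h2
  rw [sum_const, smul_eq_mul, ← mul_sum] at h1
  omega

lemma bad_unc {G : Finset (Finset (Fin n))} (hG : G ⊆ E n) (hM : Minim G) :
    3 * #(G.filter (fun e => Disjoint e (DD G))) * n ≤ 4 * #(Bad G) := by
  have h := bad_lower hG
  rw [sum_deg_sq] at h
  have h1 : 4 * ∑ e ∈ G, ∑ v ∈ e, deg G v ≤
      ∑ e ∈ G, if Disjoint e (DD G) then n else 4 * n := by
    rw [mul_sum]
    refine sum_le_sum fun e he => ?_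
    obtain ⟨a, b, hab, rfl⟩ := card_eq_two.1 (memE.1 (hG he))
    rw [sum_pair hab]
    split_ifs with hd
    · rw [disjoint_left] at hd
      have ha : a ∉ DD G := hd (by simp)
      have hb : b ∉ DD G := hd (by simp)
      simp only [DD, mem_filter, mem_univ, true_and, not_le] at ha hb
      omega
    · have := deg_half hG hM a
      have := deg_half hG hM b
      omega
  rw [sum_ite, sum_const, sum_const, smul_eq_mul, smul_eq_mul] at h1
  have h4 := card_filter_add_card_filter_not (s := G) (fun e => Disjoint e (DD G))
  rw [← h4] at h
  nlinarith

lemma bad_small {G : Finset (Finset (Fin n))} (hG : G ⊆ E n) :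
    #G * n ≤ #(Bad G) + 2 * #G ^ 2 := by
  have h := bad_lower hG
  have h1 : ∑ v, deg G v ^ 2 ≤ ∑ v, #G * deg G v := by
    refine sum_le_sum fun v _ => ?_
    rw [sq]
    exact Nat.mul_le_mul_right _ (card_le_card (filter_subset _ _))
  rw [← mul_sum, sum_deg hG] at h1
  nlinarith

end LM

namespace LM
variable {n : ℕ}

lemma card_E_le (n : ℕ) : #(E n) ≤ n ^ 2 := by
  rw [card_powersetCard, card_univ, Fintype.card_fin]; exact Nat.choose_le_pow n 2

lemma term_bound {k : ℕ} {w : ℝ} (hk : 1 ≤ k) (hkn : 12 * k ≤ n) (hw1 : w ≤ Real.log n) (hw0 : 0 ≤ w) :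
    ((#(E n)).choose k : ℝ) * Real.exp (-((2 * Real.log n + w) / n) * (k * n - 2 * k ^ 2)) ≤
      Real.exp (13 - w) ^ k := by
  set L := Real.log n with hL
  have hn : 1 ≤ n := by omega
  have hn0 : (0 : ℝ) < n := by exact_mod_cast hn
  have hk0 : (0 : ℝ) < k := by exact_mod_cast hk
  have hkn' : 12 * (k : ℝ) ≤ n := by exact_mod_cast hkn
  have hL0 : 0 ≤ L := Real.log_natCast_nonneg n
  have h1 : ((#(E n)).choose k : ℝ) ≤ Real.exp (2 * k * L + k - k * Real.log k) := by
    have a1 : ((#(E n)).choose k : ℝ) ≤ (#(E n) : ℝ) ^ k / (k.factorial : ℝ) := Nat.choose_le_pow_div k _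
    have a2 : (#(E n) : ℝ) ^ k ≤ Real.exp (2 * k * L) := by
      have : (#(E n) : ℝ) ≤ (n : ℝ) ^ 2 := by exact_mod_cast card_E_le n
      calc (#(E n) : ℝ) ^ k ≤ ((n : ℝ) ^ 2) ^ k := by gcongr
        _ = Real.exp (2 * k * L) := by
          rw [← pow_mul, mul_assoc, hL, mul_left_comm, ← mul_assoc, mul_comm (k : ℝ) 2]
          have := Real.exp_nat_mul L (2 * k)
          rw [hL, Real.exp_log hn0] at this
          rw [← this]; push_cast; rfl
    have a3 := Real.pow_div_factorial_le_exp (k : ℝ) hk0.le k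
    have a4 : (k : ℝ) ^ k = Real.exp (k * Real.log k) := by
      rw [Real.exp_nat_mul, Real.exp_log hk0]
    rw [a4] at a3
    have hf : (0 : ℝ) < (k.factorial : ℝ) := by exact_mod_cast k.factorial_pos
    rw [div_le_iff₀ hf] at a3
    refine a1.trans ?_
    rw [div_le_iff₀ hf, Real.exp_sub, Real.exp_add]
    refine a2.trans ?_
    rw [div_mul_eq_mul_div, le_div_iff₀ (Real.exp_pos _), mul_assoc (Real.exp _)]
    exact mul_le_mul_of_nonneg_left a3 (Real.exp_pos _).le
  have h2 : 6 * k * L ≤ n * (Real.log k + 12) := by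
    have hlk : 0 ≤ Real.log k := Real.log_natCast_nonneg k
    rcases le_or_gt ((k : ℝ) ^ 2) n with h | h
    · have b1 : (k : ℝ) ≤ √n := Real.le_sqrt_of_sq_le h
      have b2 : L ≤ 2 * √n := by
        have := Real.log_le_self (Real.sqrt_nonneg n)
        rw [Real.log_sqrt hn0.le] at this
        linarith
      have b3 : √(n : ℝ) * √n = n := Real.mul_self_sqrt hn0.le
      have b4 : k * L ≤ √n * (2 * √n) := by gcongr
      nlinarith
    · have b1 : L ≤ 2 * Real.log k := by
        have := Real.log_le_log hn0 h.le
        rw [Real.log_pow] at this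
        exact_mod_cast this
      nlinarith
  rw [← Real.exp_nat_mul]
  calc _ ≤ Real.exp (2 * k * L + k - k * Real.log k) *
        Real.exp (-((2 * L + w) / n) * (k * n - 2 * k ^ 2)) := by gcongr
    _ ≤ _ := by
      rw [← Real.exp_add, Real.exp_le_exp]
      have e1 : -((2 * L + w) / n) * (k * n - 2 * k ^ 2) =
        - (2 * L + w) * k + (2 * L + w) * 2 * k ^ 2 / n := by field_simp; ring
      rw [e1]
      have e2 : (2 * L + w) * 2 * k ^ 2 / n ≤ k * (Real.log k + 12) := by
        rw [div_le_iff₀ hn0]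
        nlinarith [mul_le_mul_of_nonneg_left h2 hk0.le, mul_le_mul_of_nonneg_right hw1 (sq_nonneg (k : ℝ))]
      linarith

lemma geom_le {a : ℝ} (h0 : 0 ≤ a) (h : a ≤ 1 / 2) (m : ℕ) : ∑ k ∈ Icc 1 m, a ^ k ≤ 2 * a := by
  have h2 : ∀ m : ℕ, ∑ k ∈ Icc 1 m, a ^ k ≤ 2 * a - 2 * a ^ (m + 1) := by
    intro m
    induction m with
    | zero => simp
    | succ m ih =>
      rw [sum_Icc_succ_top (by omega)]
      have : a ^ (m + 1 + 1) ≤ a ^ (m + 1) * (1 / 2) := by rw [pow_succ]; gcongr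
      have h3 : 0 ≤ a ^ (m + 1) := by positivity
      nlinarith
  have := h2 m
  have h3 : 0 ≤ a ^ (m + 1) := by positivity
  linarith

lemma small_sum {w : ℝ} (hw1 : w ≤ Real.log n) (hw0 : 0 ≤ w) (ha : Real.exp (13 - w) ≤ 1 / 2) :
    ∑ G ∈ (E n).powerset.filter (fun G => G.Nonempty ∧ 12 * #G ≤ n),
      Real.exp (-((2 * Real.log n + w) / n) * #(Bad G)) ≤ 2 * Real.exp (13 - w) := by
  refine le_trans ?_ (geom_le (Real.exp_pos _).le ha n)
  rw [← sum_fiberwise_of_maps_to (g := fun G => #G) (t := Icc 1 n)]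
  · refine sum_le_sum fun k hk => ?_
    rw [mem_Icc] at hk
    by_cases hkn : 12 * k ≤ n
    · refine le_trans ?_ (term_bound hk.1 hkn hw1 hw0)
      have hsub : filter (fun G => #G = k) ((E n).powerset.filter (fun G => G.Nonempty ∧ 12 * #G ≤ n))
          ⊆ powersetCard k (E n) := by
        intro G hG
        simp only [mem_filter, mem_powerset] at hG
        rw [mem_powersetCard]; exact ⟨hG.1.1, hG.2⟩
      rw [← card_powersetCard, ← nsmul_eq_mul, ← sum_const]
      refine le_trans (sum_le_sum_of_subset_of_nonneg hsub fun _ _ _ => (Real.exp_pos _).le) ?_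
      refine sum_le_sum fun G hG => ?_
      rw [mem_powersetCard] at hG
      rw [Real.exp_le_exp]
      have hb := bad_small hG.1
      rw [hG.2] at hb
      have hb' : (k : ℝ) * n ≤ #(Bad G) + 2 * k ^ 2 := by exact_mod_cast hb
      have hp : 0 ≤ (2 * Real.log n + w) / n := by
        have := Real.log_natCast_nonneg n
        positivity
      nlinarith
    · rw [sum_eq_zero_iff_of_nonneg (fun _ _ => (Real.exp_pos _).le) |>.2]
      · positivity
      · intro G hG
        simp only [mem_filter] at hG
        exfalso
        have := hG.1.2.2
        rw [hG.2] at this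
        omega
  · intro G hG
    simp only [mem_filter] at hG
    rw [mem_Icc]
    have := card_pos.2 hG.2.1
    omega

def ED (D : Finset (Fin n)) : Finset (Finset (Fin n)) := (E n).filter (fun e => ¬ Disjoint e D)

lemma card_ED (D : Finset (Fin n)) : #(ED D) ≤ #D * n := by
  have : ED D ⊆ D.biUnion (fun v => (E n).filter (fun e => v ∈ e)) := by
    intro e he
    unfold ED at he
    rw [mem_filter, not_disjoint_iff] at he
    obtain ⟨h1, a, h2, h3⟩ := he
    rw [mem_biUnion]
    exact ⟨a, h3, mem_filter.2 ⟨h1, h2⟩⟩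
  exact (card_le_card this).trans (card_biUnion_le_card_mul _ _ _ fun v _ => deg_E v)

open Classical in
lemma large_sum {w : ℝ} (hw0 : 0 ≤ w) (hn : 1 ≤ n) (hn2 : 144 * Real.log 2 ≤ Real.log n) :
    ∑ G ∈ (E n).powerset.filter (fun G => Minim G ∧ n < 12 * #G),
      Real.exp (-((2 * Real.log n + w) / n) * #(Bad G)) ≤
      Real.exp (-(n * Real.log n) / 108) * 2 ^ n * Real.exp n := by
  set L := Real.log n with hL
  have hn0 : (0 : ℝ) < n := by exact_mod_cast hn
  have hL0 : 0 ≤ L := Real.log_natCast_nonneg n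
  set A := Real.exp (-(n * L) / 108) with hA
  let h : (Σ _ : Finset (Fin n), Finset (Finset (Fin n)) × Finset (Finset (Fin n))) → ℝ :=
    fun x => A * (1 / 2) ^ (#x.1 * n) * (1 / n : ℝ) ^ (#x.2.2)
  let Φ : Finset (Finset (Fin n)) → (Σ _ : Finset (Fin n), Finset (Finset (Fin n)) × Finset (Finset (Fin n))) :=
    fun G => ⟨DD G, (G.filter (fun e => ¬ Disjoint e (DD G)), G.filter (fun e => Disjoint e (DD G)))⟩
  have hpos : ∀ x, 0 ≤ h x := by intro x; simp only [h, hA]; positivity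
  have hinj : Function.Injective Φ := by
    intro G G' hGG
    have e : ∀ G, (Φ G).2.2 ∪ (Φ G).2.1 = G := fun G => filter_union_filter_not_eq _ _
    rw [← e G, ← e G', hGG]
  have h1 : ∀ G ∈ (E n).powerset.filter (fun G => Minim G ∧ n < 12 * #G),
      Real.exp (-((2 * L + w) / n) * #(Bad G)) ≤ h (Φ G) := by
    intro G hG
    simp only [mem_filter, mem_powerset] at hG
    obtain ⟨hGE, hM, hk⟩ := hG
    have b1 := bad_third hGE hM
    have b2 := bad_unc hGE hM
    have b3 := card_DD hGE
    simp only [h, Φ, hA]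
    set m := #(G.filter (fun e => Disjoint e (DD G)))
    have c1 : (1 / 2 : ℝ) ^ (#(DD G) * n) = Real.exp (-(Real.log 2 * (#(DD G) * n))) := by
      rw [Real.exp_neg, mul_comm (Real.log 2), ← Nat.cast_mul, Real.exp_nat_mul, Real.exp_log (by norm_num)]; simp
    have c2 : (1 / n : ℝ) ^ m = Real.exp (-(L * m)) := by
      rw [Real.exp_neg, mul_comm, Real.exp_nat_mul, hL, Real.exp_log hn0]; simp
    rw [c1, c2, ← Real.exp_add, ← Real.exp_add, Real.exp_le_exp]
    have b1' : (n : ℝ) * #G ≤ 3 * #(Bad G) := by exact_mod_cast b1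
    have b2' : 3 * (m : ℝ) * n ≤ 4 * #(Bad G) := by exact_mod_cast b2
    have b3' : (#(DD G) : ℝ) * n ≤ 16 * #G := by exact_mod_cast b3
    have hk' : (n : ℝ) < 12 * #G := by exact_mod_cast hk
    have d1 : (n : ℝ) * (#G / 9 + m / 2) ≤ #(Bad G) := by linarith
    have d2 : (2 * L) * (#G / 9 + m / 2) ≤ (2 * L + w) / n * #(Bad G) := by
      rw [div_mul_eq_mul_div, le_div_iff₀ hn0]
      calc (2 * L) * (#G / 9 + m / 2) * n = 2 * L * (n * (#G / 9 + m / 2)) := by ring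
        _ ≤ (2 * L + w) * #(Bad G) := by
          gcongr
          linarith
    have d3 : (n : ℝ) / 24 + #(DD G) * n / 32 ≤ #G := by linarith
    have d4 := mul_le_mul_of_nonneg_left d3 hL0
    have d5 : 144 * Real.log 2 * (#(DD G) * n) ≤ L * (#(DD G) * n) := by gcongr
    nlinarith
  refine (sum_le_sum h1).trans ?_
  rw [← sum_image (f := h) (fun a _ b _ hab => hinj hab)]
  have hsub : image Φ ((E n).powerset.filter (fun G => Minim G ∧ n < 12 * #G)) ⊆
      univ.sigma (fun D => (ED D).powerset ×ˢ (E n).powerset) := by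
    intro x hx
    rw [mem_image] at hx
    obtain ⟨G, hG, rfl⟩ := hx
    simp only [mem_filter, mem_powerset] at hG
    simp only [mem_sigma, mem_univ, true_and, mem_product, mem_powerset, Φ]
    exact ⟨filter_subset_filter _ hG.1, (filter_subset _ _).trans hG.1⟩
  refine (sum_le_sum_of_subset_of_nonneg hsub fun _ _ _ => hpos _).trans ?_
  rw [sum_sigma]
  have h3 : ∀ D : Finset (Fin n), ∑ s ∈ (ED D).powerset ×ˢ (E n).powerset, h ⟨D, s⟩ ≤ A * Real.exp n := by
    intro D
    rw [sum_product]
    simp only [h]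
    rw [sum_const, ← mul_sum, nsmul_eq_mul, card_powerset]
    have e1 : ∑ F ∈ (E n).powerset, (1 / n : ℝ) ^ #F = (1 / n + 1) ^ #(E n) := by
      rw [← sum_pow_mul_eq_add_pow]
      simp
    have e2 : (1 / n + 1 : ℝ) ^ #(E n) ≤ Real.exp n := by
      calc (1 / n + 1 : ℝ) ^ #(E n) ≤ (Real.exp (1 / n)) ^ #(E n) := by
            gcongr; exact Real.add_one_le_exp _
        _ ≤ (Real.exp (1 / n)) ^ (n ^ 2) := by
            apply pow_le_pow_right₀
            · apply Real.one_le_exp; positivity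
            · exact card_E_le n
        _ = Real.exp n := by
            rw [← Real.exp_nat_mul]; congr 1; push_cast; field_simp
    rw [e1]
    have e3 : ((2 ^ #(ED D) : ℕ) : ℝ) * (1 / 2) ^ (#D * n) ≤ 1 := by
      push_cast
      calc (2 : ℝ) ^ #(ED D) * (1 / 2) ^ (#D * n) ≤ 2 ^ (#D * n) * (1 / 2) ^ (#D * n) := by
            gcongr
            · norm_num
            · exact card_ED D
        _ = 1 := by rw [← mul_pow]; norm_num
    have hA0 : 0 < A := Real.exp_pos _
    calc ((2 ^ #(ED D) : ℕ) : ℝ) * (A * (1 / 2) ^ (#D * n) * (1 / n + 1) ^ #(E n))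
        = (((2 ^ #(ED D) : ℕ) : ℝ) * (1 / 2) ^ (#D * n)) * (A * (1 / n + 1) ^ #(E n)) := by ring
      _ ≤ 1 * (A * Real.exp n) := by gcongr
      _ = _ := one_mul _
  refine (sum_le_sum fun D _ => h3 D).trans (le_of_eq ?_)
  rw [sum_const, nsmul_eq_mul, card_univ, Fintype.card_finset, Fintype.card_fin]
  push_cast
  ring

end LM

namespace LM
variable {n : ℕ}

def cl (p : ℝ) : ℝ := max 0 (min p 1)
lemma cl_nonneg (p : ℝ) : 0 ≤ cl p := le_max_left _ _
lemma cl_le_one (p : ℝ) : cl p ≤ 1 := max_le zero_le_one (min_le_right _ _)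

instance (p : ℝ) : IsProbabilityMeasure (bernoulliBool p) := by
  constructor
  simp only [bernoulliBool, Measure.add_apply, Measure.smul_apply, smul_eq_mul,
    measure_univ, mul_one]
  change ENNReal.ofReal (cl p) + ENNReal.ofReal (1 - cl p) = 1
  rw [← ENNReal.ofReal_add (cl_nonneg p) (by linarith [cl_le_one p])]
  simp

instance (d : ℕ) (p : ℝ) : IsProbabilityMeasure (YMeasure n d p) := by
  unfold YMeasure; infer_instance

lemma bern_false (p : ℝ) : bernoulliBool p {false} = ENNReal.ofReal (1 - cl p) := by
  simp [bernoulliBool, cl]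

lemma meas_false (p : ℝ) (S : Finset (FaceIdx n 2)) :
    YMeasure n 2 p {ω | ∀ t ∈ S, ω t = false} = ENNReal.ofReal ((1 - cl p) ^ #S) := by
  have h : {ω : FaceIdx n 2 → Bool | ∀ t ∈ S, ω t = false} =
      Set.pi Set.univ (fun t => if t ∈ S then {false} else Set.univ) := by
    ext ω
    simp only [Set.mem_setOf_eq, Set.mem_pi, Set.mem_univ, true_implies]
    refine forall_congr' fun t => ?_
    by_cases ht : t ∈ S <;> simp [ht]
  rw [h, YMeasure, Measure.pi_pi]
  have h2 : ∀ t : FaceIdx n 2, bernoulliBool p (if t ∈ S then {false} else Set.univ) =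
      if t ∈ S then ENNReal.ofReal (1 - cl p) else 1 := by
    intro t
    split_ifs
    · exact bern_false p
    · exact measure_univ
  simp_rw [h2]
  rw [prod_ite_mem, univ_inter, prod_const, ENNReal.ofReal_pow (by linarith [cl_le_one p])]

lemma meas_all (s : Set (FaceIdx n 2 → Bool)) : MeasurableSet s := s.toFinite.measurableSet

def sub3 (B : Finset (Finset (Fin n))) : Finset (FaceIdx n 2) := univ.filter (fun t => t.1 ∈ B)

lemma card_sub3 {B : Finset (Finset (Fin n))} (hB : B ⊆ T n) : #(sub3 B) = #B := by
  refine card_bij (fun t _ => t.1) ?_ ?_ ?_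
  · intro t ht; exact (mem_filter.1 ht).2
  · intro a _ b _ h; exact Subtype.ext h
  · intro t ht
    exact ⟨⟨t, memT.1 (hB ht)⟩, mem_filter.2 ⟨mem_univ _, ht⟩, rfl⟩

open Classical in
lemma upper_bound {p w : ℝ} (hn : 1 ≤ n) (hp : (2 * Real.log n + w) / n ≤ p)
    (hw1 : w ≤ Real.log n) (hw0 : 0 ≤ w) (ha : Real.exp (13 - w) ≤ 1 / 2)
    (hn2 : 144 * Real.log 2 ≤ Real.log n) :
    YMeasure n 2 p {ω | ¬ HomologyZero (Ycomplex n 2 ω) 1 (ZMod 2)} ≤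
      ENNReal.ofReal (2 * Real.exp (13 - w) + Real.exp (-(n * Real.log n) / 108) * 2 ^ n * Real.exp n) := by
  set S := (E n).powerset.filter (fun G => G.Nonempty ∧ Minim G) with hS
  have h1 : {ω : FaceIdx n 2 → Bool | ¬ HomologyZero (Ycomplex n 2 ω) 1 (ZMod 2)} ⊆
      ⋃ G ∈ S, {ω | ∀ t ∈ sub3 (Bad G), ω t = false} := by
    intro ω hω
    obtain ⟨G, hG, h2, h3, h4⟩ := exists_minim ω hω
    simp only [Set.mem_iUnion]
    refine ⟨G, mem_filter.2 ⟨mem_powerset.2 hG, h2, h3⟩, ?_⟩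
    intro t ht
    exact h4 t.1 t.2 (mem_filter.1 ht).2
  have hq : 1 - cl p ≤ Real.exp (-((2 * Real.log n + w) / n)) := by
    by_cases h : p ≤ 1
    · have : p ≤ cl p := by unfold cl; rw [min_eq_left h]; exact le_max_right _ _
      have := Real.add_one_le_exp (-((2 * Real.log n + w) / n))
      linarith
    · have : cl p = 1 := by unfold cl; rw [min_eq_right (by linarith)]; simp
      rw [this]; simp [Real.exp_nonneg]
  refine (measure_mono h1).trans ((measure_biUnion_finset_le _ _).trans ?_)
  have h2 : ∀ G ∈ S, YMeasure n 2 p {ω | ∀ t ∈ sub3 (Bad G), ω t = false} ≤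
      ENNReal.ofReal (Real.exp (-((2 * Real.log n + w) / n) * #(Bad G))) := by
    intro G _
    rw [meas_false, card_sub3 (B := Bad G) (filter_subset _ _)]
    apply ENNReal.ofReal_le_ofReal
    rw [mul_comm, Real.exp_nat_mul]
    exact pow_le_pow_left₀ (by linarith [cl_le_one p]) hq _
  refine (sum_le_sum h2).trans ?_
  rw [← ENNReal.ofReal_sum_of_nonneg (fun _ _ => (Real.exp_pos _).le)]
  apply ENNReal.ofReal_le_ofReal
  refine le_trans ?_ (add_le_add (small_sum hw1 hw0 ha) (large_sum hw0 hn hn2))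
  rw [← sum_filter_add_sum_filter_not S (fun G => 12 * #G ≤ n)]
  apply add_le_add
  · apply sum_le_sum_of_subset_of_nonneg
    · intro G hG
      simp only [hS, mem_filter] at hG ⊢
      exact ⟨hG.1.1, hG.1.2.1, hG.2⟩
    · intros; exact (Real.exp_pos _).le
  · apply sum_le_sum_of_subset_of_nonneg
    · intro G hG
      simp only [hS, mem_filter, not_le] at hG ⊢
      exact ⟨hG.1.1, hG.1.2.2, hG.2⟩
    · intros; exact (Real.exp_pos _).le

lemma tendsto_logn : Tendsto (fun n : ℕ => Real.log n) atTop atTop :=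
  Real.tendsto_log_atTop.comp tendsto_natCast_atTop_atTop

lemma tendsto_one_of_compl {P : ∀ n : ℕ, (FaceIdx n 2 → Bool) → Prop} {p : ℕ → ℝ} {r : ℕ → ℝ}
    (hr : Tendsto r atTop (nhds 0))
    (h : ∀ᶠ n in atTop, YMeasure n 2 (p n) {ω | ¬ P n ω} ≤ ENNReal.ofReal (r n)) :
    Tendsto (fun n => YMeasure n 2 (p n) {ω | P n ω}) atTop (nhds 1) := by
  have h1 : Tendsto (fun n => 1 - ENNReal.ofReal (r n)) atTop (nhds 1) := by
    have : Tendsto (fun n => ENNReal.ofReal (r n)) atTop (nhds 0) := by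
      have := ENNReal.tendsto_ofReal hr
      simpa using this
    have := ENNReal.Tendsto.sub (tendsto_const_nhds (x := (1 : ENNReal)) (f := atTop)) this (Or.inl (by simp))
    simpa using this
  refine tendsto_of_tendsto_of_tendsto_of_le_of_le' h1 tendsto_const_nhds ?_ ?_
  · filter_upwards [h] with n hn
    have e : {ω | P n ω} = {ω | ¬ P n ω}ᶜ := by ext; simp
    rw [e, prob_compl_eq_one_sub (meas_all _)]
    exact tsub_le_tsub_left hn _
  · exact Eventually.of_forall fun n => prob_le_one

lemma part1 (w : ℕ → ℝ) (hw : Tendsto w atTop atTop) (p : ℕ → ℝ)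
    (hp : ∀ n : ℕ, (2 * Real.log n + w n) / n ≤ p n) :
    Tendsto (fun n : ℕ => YMeasure n 2 (p n)
          {ω | HomologyZero (Ycomplex n 2 ω) 1 (ZMod 2)})
        atTop (nhds (1 : ENNReal)) := by
  set w' : ℕ → ℝ := fun n => min (w n) (Real.log n) with hw'
  have tw : Tendsto w' atTop atTop := tendsto_atTop_mono' _ (Eventually.of_forall fun n => le_rfl)
    (Filter.tendsto_atTop.2 fun b => by
      filter_upwards [tendsto_atTop.1 hw b, tendsto_atTop.1 tendsto_logn b] with n h1 h2
      exact le_min h1 h2)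
  have te : Tendsto (fun n => Real.exp (13 - w' n)) atTop (nhds 0) := by
    apply Real.tendsto_exp_atBot.comp
    exact tendsto_atBot_add_const_left _ 13 (tendsto_neg_atTop_atBot.comp tw)
  refine tendsto_one_of_compl (r := fun n => 2 * Real.exp (13 - w' n) +
    Real.exp (-(n * Real.log n) / 108) * 2 ^ n * Real.exp n) ?_ ?_
  · have t2 : Tendsto (fun n : ℕ => Real.exp (-(n * Real.log n) / 108) * 2 ^ n * Real.exp n) atTop (nhds 0) := by
      have t3 : Tendsto (fun n : ℕ => Real.exp (-(n : ℝ))) atTop (nhds 0) :=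
        Real.tendsto_exp_atBot.comp (tendsto_neg_atTop_atBot.comp tendsto_natCast_atTop_atTop)
      refine tendsto_of_tendsto_of_tendsto_of_le_of_le' tendsto_const_nhds t3 ?_ ?_
      · exact Eventually.of_forall fun n => by positivity
      · filter_upwards [tendsto_atTop.1 tendsto_logn (108 * 3)] with n hn
        have e2 : (2 : ℝ) ^ n ≤ Real.exp n := by
          have : (2 : ℝ) ≤ Real.exp 1 := by linarith [Real.add_one_le_exp 1]
          calc (2 : ℝ) ^ n ≤ Real.exp 1 ^ n := by gcongr
            _ = Real.exp n := by rw [← Real.exp_nat_mul, mul_one]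
        calc Real.exp (-(n * Real.log n) / 108) * 2 ^ n * Real.exp n
            ≤ Real.exp (-(n * Real.log n) / 108) * Real.exp n * Real.exp n := by gcongr
          _ ≤ _ := by
            rw [← Real.exp_add, ← Real.exp_add, Real.exp_le_exp]
            have : (0 : ℝ) ≤ n := by positivity
            nlinarith
    simpa using (te.const_mul 2).add t2
  · filter_upwards [eventually_ge_atTop 1, tendsto_atTop.1 tw 0, te.eventually (Iic_mem_nhds (show (0 : ℝ) < 1 / 2 by norm_num)),
      tendsto_atTop.1 tendsto_logn (144 * Real.log 2)] with n h1 h2 h3 h4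
    refine upper_bound h1 (le_trans ?_ (hp n)) (min_le_right _ _) h2 h3 h4
    gcongr
    exact min_le_left _ _

lemma not_HZ {ω : FaceIdx n 2 → Bool} (hn : 3 ≤ n) {e : Finset (Fin n)} (he : e ∈ E n)
    (h : ∀ t : FaceIdx n 2, e ⊆ t.1 → ω t = false) :
    ¬ HomologyZero (Ycomplex n 2 ω) 1 (ZMod 2) := by
  intro H
  rw [memE] at he
  obtain ⟨c, hc⟩ : ∃ c, c ∉ e := by
    by_contra hcon
    push Not at hcon
    have : e = univ := eq_univ_of_forall hcon
    rw [this] at he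
    simp at he
    omega
  set t := insert c e with ht
  have htc : #t = 3 := by rw [ht, card_insert_of_notMem hc, he]
  set K := Ycomplex n 2 ω with hK
  let z : Chains K (1 + 1) (ZMod 2) := fun τ => if τ.1 ⊆ t then 1 else 0
  have hz : chainBoundary K 1 z = 0 := by
    funext τ
    rw [chainB]
    obtain ⟨u, hu⟩ := card_eq_one.1 τ.2.2
    rw [hu]
    have h1 : ∀ v : Fin n, (if v ∉ ({u} : Finset (Fin n)) then ext z (insert v {u}) else 0) =
        if v ∈ t.erase u then (if u ∈ t then 1 else 0) else 0 := by
      intro v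
      by_cases hv : v = u
      · subst hv; simp
      · have h2 : insert v {u} ∈ K ∧ #(insert v {u}) = 1 + 1 := by
          have : #(insert v {u} : Finset (Fin n)) = 2 := card_pair hv
          exact ⟨mem_K2 ω this.le, this⟩
        rw [if_pos (by simpa using hv), ext, dif_pos h2]
        simp only [z, insert_subset_iff, singleton_subset_iff, mem_erase]
        by_cases a : v ∈ t <;> by_cases b : u ∈ t <;> simp [a, b, hv]
    simp_rw [h1]
    rw [sum_ite_mem, univ_inter, sum_const]
    by_cases b : u ∈ t
    · rw [card_erase_of_mem b, htc]
      simp [b]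
      decide
    · simp [b]
  obtain ⟨g, hg⟩ := H z hz
  have hh := congrFun hg ⟨e, mem_K2 ω he.le, he⟩
  rw [chainB] at hh
  simp only [z] at hh
  rw [if_pos (subset_insert _ _), sum_eq_zero] at hh
  · exact zero_ne_one hh
  · intro v _
    split_ifs with hv
    · rfl
    · rw [ext, dif_neg]
      rintro ⟨h3, h4⟩
      have h5 := (mem_K3 ω h4).1 h3
      rw [h ⟨insert v e, h4⟩ (subset_insert _ _)] at h5
      simp at h5

def Tf (e : Finset (Fin n)) : Finset (FaceIdx n 2) := sub3 ((T n).filter (fun t => e ⊆ t))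

lemma card_Tf {e : Finset (Fin n)} (he : e ∈ E n) : #(Tf e) = n - 2 := by
  rw [Tf, card_sub3 (filter_subset _ _)]
  have := card_T_sup (memE.1 he)
  omega

lemma card_Tf_union {e f : Finset (Fin n)} (he : e ∈ E n) (hf : f ∈ E n) (h : e ≠ f) :
    2 * (n - 2) - 1 ≤ #(Tf e ∪ Tf f) := by
  have h1 := card_union_add_card_inter (Tf e) (Tf f)
  rw [card_Tf he, card_Tf hf] at h1
  have h2 : #(Tf e ∩ Tf f) ≤ 1 := by
    have : Tf e ∩ Tf f = sub3 ((T n).filter (fun t => e ⊆ t ∧ f ⊆ t)) := by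
      ext t
      simp only [Tf, sub3, mem_inter, mem_filter, mem_univ, true_and]
      tauto
    rw [this, card_sub3 (filter_subset _ _)]
    refine (card_T_two (memE.1 he) (memE.1 hf) h).trans ?_
    by_contra hc
    push Not at hc
    rw [memE] at he hf
    have h1 : e ∩ f = e := eq_of_subset_of_card_le inter_subset_left (by omega)
    have h2 : e ∩ f = f := eq_of_subset_of_card_le inter_subset_right (by omega)
    exact h (h1.symm.trans h2)
  omega

def AA (e : Finset (Fin n)) : Set (FaceIdx n 2 → Bool) := {ω | ∀ t ∈ Tf e, ω t = false}

lemma second_moment (hn : 3 ≤ n) (p : ℝ) (hq : 0 < 1 - cl p) :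
    (YMeasure n 2 p).real {ω | HomologyZero (Ycomplex n 2 ω) 1 (ZMod 2)} ≤
      1 / (#(E n) * (1 - cl p) ^ (n - 2)) + (1 / (1 - cl p) - 1) := by
  set q := 1 - cl p with hqd
  have hq1 : q ≤ 1 := by have := cl_nonneg p; linarith
  set μ := YMeasure n 2 p with hμ
  set M : ℝ := #(E n) * q ^ (n - 2) with hM
  have hE : 0 < #(E n) := by
    rw [card_powersetCard, card_univ, Fintype.card_fin]; exact Nat.choose_pos (by omega)
  have hM0 : 0 < M := by positivity
  have hmA : ∀ e ∈ E n, μ.real (AA e) = q ^ (n - 2) := by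
    intro e he
    rw [measureReal_def, AA, meas_false, card_Tf he, ENNReal.toReal_ofReal (by positivity)]
  have hmAA : ∀ e ∈ E n, ∀ f ∈ E n, μ.real (AA e ∩ AA f) ≤
      q ^ (2 * (n - 2)) / q + if e = f then q ^ (n - 2) else 0 := by
    intro e he f hf
    split_ifs with h
    · subst h
      rw [Set.inter_self, hmA e he]
      have : 0 ≤ q ^ (2 * (n - 2)) / q := by positivity
      linarith
    · rw [add_zero]
      have : AA e ∩ AA f = {ω | ∀ t ∈ Tf e ∪ Tf f, ω t = false} := by
        ext ω
        simp only [AA, Set.mem_inter_iff, Set.mem_setOf_eq, mem_union]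
        constructor
        · rintro ⟨a, b⟩ t (c | c)
          · exact a t c
          · exact b t c
        · intro a; exact ⟨fun t c => a t (Or.inl c), fun t c => a t (Or.inr c)⟩
      rw [this, measureReal_def, meas_false, ENNReal.toReal_ofReal (by positivity)]
      calc q ^ #(Tf e ∪ Tf f) ≤ q ^ (2 * (n - 2) - 1) :=
            pow_le_pow_of_le_one hq.le hq1 (card_Tf_union he hf h)
        _ = q ^ (2 * (n - 2)) / q := by
            rw [eq_div_iff hq.ne', ← pow_succ]; congr 1; omega
  set X : (FaceIdx n 2 → Bool) → ℝ := fun ω => ∑ e ∈ E n, (AA e).indicator 1 ω with hX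
  have hX0 : ∀ ω, HomologyZero (Ycomplex n 2 ω) 1 (ZMod 2) → X ω = 0 := by
    intro ω hω
    refine sum_eq_zero fun e he => ?_
    rw [Set.indicator_of_notMem]
    intro hA
    refine not_HZ hn he (fun t ht => hA t ?_) hω
    simp only [Tf, sub3, mem_filter, mem_univ, true_and, memT]
    exact ⟨t.2, ht⟩
  have hint : ∀ g : (FaceIdx n 2 → Bool) → ℝ, Integrable g μ := fun g => Integrable.of_finite
  have i1 : ∫ ω, X ω ∂μ = M := by
    simp only [hX]
    rw [integral_finset_sum _ (fun _ _ => hint _)]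
    rw [sum_congr rfl (g := fun _ => q ^ (n - 2))]
    · rw [sum_const, nsmul_eq_mul]
    · intro e he
      rw [integral_indicator_one (meas_all _), hmA e he]
  have i2 : ∫ ω, X ω ^ 2 ∂μ ≤ M ^ 2 / q + M := by
    have : ∀ ω, X ω ^ 2 = ∑ e ∈ E n, ∑ f ∈ E n, (AA e ∩ AA f).indicator 1 ω := by
      intro ω
      simp only [hX]
      rw [sq, sum_mul_sum]
      refine sum_congr rfl fun e _ => sum_congr rfl fun f _ => ?_
      rw [Set.inter_indicator_one]; rfl
    simp_rw [this]
    rw [integral_finset_sum _ (fun _ _ => hint _)]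
    have e1 : ∀ e ∈ E n, ∫ ω, ∑ f ∈ E n, (AA e ∩ AA f).indicator (1 : (FaceIdx n 2 → Bool) → ℝ) ω ∂μ =
        ∑ f ∈ E n, μ.real (AA e ∩ AA f) := by
      intro e he
      rw [integral_finset_sum _ (fun _ _ => hint _)]
      exact sum_congr rfl fun f _ => integral_indicator_one (meas_all _)
    rw [sum_congr rfl e1]
    refine (sum_le_sum fun e he => sum_le_sum fun f hf => hmAA e he f hf).trans (le_of_eq ?_)
    simp_rw [sum_add_distrib]
    congr 1
    · rw [sum_const, sum_const, nsmul_eq_mul, nsmul_eq_mul, hM]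
      ring
    · rw [sum_congr rfl (g := fun _ => q ^ (n - 2))]
      · rw [sum_const, nsmul_eq_mul]
      · intro e he; rw [sum_ite_eq, if_pos he]
  set S := {ω : FaceIdx n 2 → Bool | HomologyZero (Ycomplex n 2 ω) 1 (ZMod 2)} with hS
  have i3 : M ^ 2 * μ.real S ≤ ∫ ω, (X ω - M) ^ 2 ∂μ := by
    have : M ^ 2 * μ.real S = ∫ ω, M ^ 2 * S.indicator 1 ω ∂μ := by
      rw [integral_const_mul, integral_indicator_one (meas_all _)]
    rw [this]
    refine integral_mono (hint _) (hint _) fun ω => ?_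
    by_cases h : ω ∈ S
    · simp only [Set.indicator_of_mem h, hX0 ω h]; simp
    · simp only [Set.indicator_of_notMem h]; rw [mul_zero]; positivity
  have i4 : ∫ ω, (X ω - M) ^ 2 ∂μ = ∫ ω, X ω ^ 2 ∂μ - M ^ 2 := by
    have : ∀ ω, (X ω - M) ^ 2 = X ω ^ 2 - (2 * M) * X ω + M ^ 2 := fun ω => by ring
    simp_rw [this]
    rw [integral_add (hint _) (hint _), integral_sub (hint _) (hint _), integral_const_mul, i1]
    simp
    ring
  have i5 : M ^ 2 * μ.real S ≤ M ^ 2 / q + M - M ^ 2 := by linarith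
  have : μ.real S ≤ (M ^ 2 / q + M - M ^ 2) / M ^ 2 := by
    rw [le_div_iff₀ (by positivity)]; linarith
  refine this.trans (le_of_eq ?_)
  field_simp
  ring

end LM

namespace LM
variable {n : ℕ}

lemma lower_bound {p w : ℝ} (hn : 3 ≤ n) (hp : p ≤ (2 * Real.log n - w) / n)
    (hw1 : w ≤ 2 * Real.log n) (hw0 : 0 ≤ w) (hL2 : Real.log n ^ 2 ≤ n) (hL : 2 * Real.log n / n ≤ 1 / 2) :
    YMeasure n 2 p {ω | ¬ ¬ HomologyZero (Ycomplex n 2 ω) 1 (ZMod 2)} ≤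
      ENNReal.ofReal (4 * Real.exp (8 - w) + 2 * (2 * Real.log n / n)) := by
  simp only [not_not]
  set L := Real.log n with hLd
  have hn0 : (0 : ℝ) < n := by positivity
  have hn3 : (3 : ℝ) ≤ n := by exact_mod_cast hn
  have hL0 : 0 ≤ L := Real.log_natCast_nonneg n
  have hc1 : cl p ≤ (2 * L - w) / n := by
    unfold cl
    apply max_le
    · apply div_nonneg <;> linarith
    · exact (min_le_left _ _).trans hp
  have hc2 : cl p ≤ 2 * L / n := hc1.trans (by gcongr; linarith)
  have hc0 := cl_nonneg p
  set c := cl p with hc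
  have hch : c ≤ 1 / 2 := hc2.trans hL
  have hq : 0 < 1 - c := by linarith
  have key := second_moment hn p hq
  rw [← hc] at key
  have b1 : 1 / (1 - c) - 1 ≤ 2 * (2 * L / n) := by
    have : 1 / (1 - c) - 1 ≤ 2 * c := by
      rw [sub_le_iff_le_add, div_le_iff₀ hq]; nlinarith
    linarith
  have b2 : Real.exp (-(2 * L - w) - 8) ≤ (1 - c) ^ (n - 2) := by
    have l1 : -c - 2 * c ^ 2 ≤ Real.log (1 - c) := by
      refine le_trans ?_ (Real.one_sub_inv_le_log_of_pos hq)
      have : (1 - c)⁻¹ ≤ 1 + c + 2 * c ^ 2 := by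
        rw [inv_le_iff_one_le_mul₀ hq]
        nlinarith [mul_nonneg (sq_nonneg c) (sub_nonneg.2 hch)]
      linarith
    have l2 : Real.exp (-(2 * L - w) - 8) ≤ Real.exp (n * Real.log (1 - c)) := by
      rw [Real.exp_le_exp]
      have m1 : n * c ≤ 2 * L - w := by rw [le_div_iff₀ hn0] at hc1; linarith
      have m2 : n * c ≤ 2 * L := by linarith
      have m3 : (n * c) ^ 2 ≤ (2 * L) ^ 2 := by gcongr
      have m4 : n * c ^ 2 ≤ 4 := by
        have : n * (n * c ^ 2) ≤ n * 4 := by nlinarith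
        exact le_of_mul_le_mul_left this hn0
      nlinarith [mul_le_mul_of_nonneg_left l1 hn0.le]
    refine l2.trans ?_
    rw [Real.exp_nat_mul, Real.exp_log hq]
    exact pow_le_pow_of_le_one hq.le (by linarith) (Nat.sub_le _ _)
  have b3 : (n : ℝ) ^ 2 / 4 ≤ #(E n) := by
    rw [card_powersetCard, card_univ, Fintype.card_fin, Nat.cast_choose_two]
    nlinarith
  have b4 : Real.exp (w - 8) / 4 ≤ #(E n) * (1 - c) ^ (n - 2) := by
    have : Real.exp (w - 8) / 4 = (n : ℝ) ^ 2 / 4 * Real.exp (-(2 * L - w) - 8) := by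
      have e1 : (n : ℝ) ^ 2 = Real.exp (2 * L) := by
        have := Real.exp_nat_mul L 2
        rw [hLd, Real.exp_log hn0] at this
        rw [← this]; push_cast; rfl
      rw [e1, div_mul_eq_mul_div, ← Real.exp_add]
      congr 2; ring
    rw [this]
    gcongr
  have b5 : 1 / (#(E n) * (1 - c) ^ (n - 2)) ≤ 4 * Real.exp (8 - w) := by
    calc 1 / (#(E n) * (1 - c) ^ (n - 2)) ≤ 1 / (Real.exp (w - 8) / 4) :=
          one_div_le_one_div_of_le (by positivity) b4
      _ = 4 * Real.exp (8 - w) := by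
          rw [one_div_div, show 8 - w = -(w - 8) by ring, Real.exp_neg]; rfl
  rw [← ENNReal.ofReal_toReal (measure_ne_top (YMeasure n 2 p) _)]
  apply ENNReal.ofReal_le_ofReal
  rw [measureReal_def] at key
  linarith

lemma part2 (w : ℕ → ℝ) (hw : Tendsto w atTop atTop) (p : ℕ → ℝ)
    (hp : ∀ n : ℕ, p n ≤ (2 * Real.log n - w n) / n) :
    Tendsto (fun n : ℕ => YMeasure n 2 (p n)
          {ω | ¬ HomologyZero (Ycomplex n 2 ω) 1 (ZMod 2)})
        atTop (nhds (1 : ENNReal)) := by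
  set w' : ℕ → ℝ := fun n => min (w n) (2 * Real.log n) with hw'
  have t2 : Tendsto (fun n : ℕ => 2 * Real.log n) atTop atTop :=
    tendsto_logn.const_mul_atTop (by norm_num)
  have tw : Tendsto w' atTop atTop := Filter.tendsto_atTop.2 fun b => by
      filter_upwards [tendsto_atTop.1 hw b, tendsto_atTop.1 t2 b] with n h1 h2
      exact le_min h1 h2
  have te : Tendsto (fun n => Real.exp (8 - w' n)) atTop (nhds 0) := by
    apply Real.tendsto_exp_atBot.comp
    exact tendsto_atBot_add_const_left _ 8 (tendsto_neg_atTop_atBot.comp tw)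
  have tl : Tendsto (fun n : ℕ => 2 * Real.log n / n) atTop (nhds 0) := by
    have h := (Real.isLittleO_log_id_atTop.tendsto_div_nhds_zero).comp (tendsto_natCast_atTop_atTop (R := ℝ))
    have := h.const_mul 2
    simpa [Function.comp_def, mul_div_assoc] using this
  have tl2 : ∀ᶠ n : ℕ in atTop, Real.log n ^ 2 ≤ n := by
    have h := (Real.isLittleO_pow_log_id_atTop (n := 2)).bound (zero_lt_one)
    filter_upwards [tendsto_natCast_atTop_atTop.eventually h] with n hn
    simpa using hn
  refine tendsto_one_of_compl (P := fun n ω => ¬ HomologyZero (Ycomplex n 2 ω) 1 (ZMod 2))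
    (r := fun n => 4 * Real.exp (8 - w' n) + 2 * (2 * Real.log n / n)) ?_ ?_
  · simpa using (te.const_mul 4).add (tl.const_mul 2)
  · filter_upwards [eventually_ge_atTop 3, tendsto_atTop.1 tw 0, tl2,
      tl.eventually (Iic_mem_nhds (show (0 : ℝ) < 1 / 2 by norm_num))] with n h1 h2 h3 h4
    refine lower_bound h1 ((hp n).trans ?_) (min_le_right _ _) h2 h3 h4
    gcongr
    exact min_le_left _ _

end LM


noncomputable section
/-- **The Linial–Meshulam theorem.** For the random 2-complex `Y(n,p)`:
if `p ≥ (2 log n + ω(n))/n` then w.h.p. `H₁(Y, ℤ/2) = 0`, and if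
`p ≤ (2 log n − ω(n))/n` then w.h.p. `H₁(Y, ℤ/2) ≠ 0`. -/
theorem linial_meshulam (w : ℕ → ℝ) (hw : Tendsto w atTop atTop) (p : ℕ → ℝ) :
    ((∀ n : ℕ, (2 * Real.log n + w n) / n ≤ p n) →
      Tendsto (fun n : ℕ => YMeasure n 2 (p n)
          {ω | HomologyZero (Ycomplex n 2 ω) 1 (ZMod 2)})
        atTop (nhds (1 : ENNReal))) ∧
    ((∀ n : ℕ, p n ≤ (2 * Real.log n - w n) / n) →
      Tendsto (fun n : ℕ => YMeasure n 2 (p n)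
          {ω | ¬ HomologyZero (Ycomplex n 2 ω) 1 (ZMod 2)})
        atTop (nhds (1 : ENNReal))) := by
  exact ⟨LM.part1 w hw p, LM.part2 w hw p⟩
end
end

section
/- Fix d ≥ 1, let G be a nontrivial finite abelian group, let ω: ℕ → ℝ be any function with ω(n) → ∞, and let Y = Y_d(n,p). If p ≥ (d log n + ω(n))/n, then w.h.p. H_{d−1}(Y, G) = 0 (reduced homology when d = 1); and if p ≤ (d log n − ω(n))/n, then w.h.p. H_{d−1}(Y, G) ≠ 0. -/
open MeasureTheory Filter Finset Matrix

open MeasureTheory Filter Finset Matrix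
noncomputable section
namespace MW

variable {n : ℕ} {R : Type} [AddCommGroup R]

/-- sign -/
def sg (v : Fin n) (τ : Finset (Fin n)) : ℤ := (-1 : ℤ) ^ (τ.filter (fun u => u < v)).card

lemma sg_mul_self (v : Fin n) (τ : Finset (Fin n)) : sg v τ * sg v τ = 1 := by
  unfold sg
  rw [← mul_pow]; simp

lemma sg_ne (v : Fin n) (τ : Finset (Fin n)) (x : R) (h : sg v τ • x ≠ 0) : x ≠ 0 := by
  rintro rfl; simp at h

lemma sg_insert (u v : Fin n) (ρ : Finset (Fin n)) (hu : u ∉ ρ) :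
    sg v (insert u ρ) = if u < v then - sg v ρ else sg v ρ := by
  unfold sg
  rw [Finset.filter_insert]
  split_ifs with h
  · rw [Finset.card_insert_of_notMem (by simp [hu]), pow_succ]; ring
  · rfl

lemma sg_anti (u v : Fin n) (ρ : Finset (Fin n)) (huv : u ≠ v) (hu : u ∉ ρ) (hv : v ∉ ρ) :
    sg u ρ * sg v (insert u ρ) = -(sg v ρ * sg u (insert v ρ)) := by
  rw [sg_insert u v ρ hu, sg_insert v u ρ hv]
  rcases lt_or_gt_of_ne huv with h | h
  · rw [if_pos h, if_neg h.not_gt]; ring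
  · rw [if_neg h.not_gt, if_pos h]; ring

/-- coboundary -/
def cob (φ : Finset (Fin n) → R) (τ : Finset (Fin n)) : R :=
  ∑ v ∈ τ, sg v (τ.erase v) • φ (τ.erase v)

lemma cob_sub (φ ψ : Finset (Fin n) → R) (τ) :
    cob (fun s => φ s - ψ s) τ = cob φ τ - cob ψ τ := by
  simp [cob, smul_sub, Finset.sum_sub_distrib]

lemma cob_cob (φ : Finset (Fin n) → R) (τ) : cob (cob φ) τ = 0 := by
  unfold cob
  simp_rw [Finset.smul_sum]
  rw [Finset.sum_sigma']
  refine Finset.sum_involution (fun a _ => ⟨a.2, a.1⟩) ?_ ?_ ?_ ?_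
  · rintro ⟨v, u⟩ h
    simp only [Finset.mem_sigma, Finset.mem_erase] at h
    obtain ⟨hv, huv, hu⟩ := h
    have e : (τ.erase v).erase u = (τ.erase u).erase v := Finset.erase_right_comm
    simp only
    rw [← e]
    set ρ := (τ.erase v).erase u with hρ
    have hvρ : v ∉ ρ := by simp [hρ]
    have huρ : u ∉ ρ := by simp [hρ]
    have e1 : τ.erase v = insert u ρ := by
      rw [hρ, Finset.insert_erase]; simp [huv, hu]
    have e2 : τ.erase u = insert v ρ := by
      rw [e, Finset.insert_erase]; simp [huv.symm, hv]
    rw [e1, e2, smul_smul, smul_smul, ← add_smul]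
    have := sg_anti u v ρ huv huρ hvρ
    rw [mul_comm (sg v (insert u ρ)), this, mul_comm (sg u (insert v ρ))]
    simp
  · rintro ⟨v, u⟩ h _ heq
    simp only [Finset.mem_sigma, Finset.mem_erase] at h
    simp at heq
    exact h.2.1 heq.1
  · rintro ⟨v, u⟩ h
    simp only [Finset.mem_sigma, Finset.mem_erase] at h ⊢
    exact ⟨h.2.2, h.2.1.symm, h.1⟩
  · rintro ⟨v, u⟩ h
    rfl

/-- boundary on total functions -/
def bd (F : Finset (Fin n) → R) (ρ : Finset (Fin n)) : R :=
  ∑ v ∈ ρᶜ, sg v ρ • F (insert v ρ)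

lemma bd_bd (F : Finset (Fin n) → R) (ρ) : bd (bd F) ρ = 0 := by
  unfold bd
  simp_rw [Finset.smul_sum]
  rw [Finset.sum_sigma']
  refine Finset.sum_involution (fun a _ => ⟨a.2, a.1⟩) ?_ ?_ ?_ ?_
  · rintro ⟨v, u⟩ h
    simp only [Finset.mem_sigma, Finset.mem_compl, Finset.mem_insert, not_or] at h
    obtain ⟨hv, huv, hu⟩ := h
    simp only
    rw [Finset.insert_comm v u, smul_smul, smul_smul, ← add_smul, sg_anti u v ρ huv hu hv]
    simp
  · rintro ⟨v, u⟩ h _ heq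
    simp only [Finset.mem_sigma, Finset.mem_compl, Finset.mem_insert, not_or] at h
    simp at heq
    exact h.2.1 heq.1
  · rintro ⟨v, u⟩ h
    simp only [Finset.mem_sigma, Finset.mem_compl, Finset.mem_insert, not_or] at h ⊢
    exact ⟨h.2.2, Ne.symm h.2.1, h.1⟩
  · rintro ⟨v, u⟩ h
    rfl

/-- cone operator -/
def cone (v : Fin n) (φ : Finset (Fin n) → R) (ρ : Finset (Fin n)) : R :=
  if v ∈ ρ then 0 else sg v ρ • φ (insert v ρ)

lemma cone_mem (v : Fin n) (φ : Finset (Fin n) → R) (σ) (h : v ∈ σ) :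
    cob (cone v φ) σ = φ σ := by
  unfold cob
  rw [Finset.sum_eq_single v]
  · simp only [cone]
    rw [if_neg (by simp), smul_smul, sg_mul_self, one_smul, Finset.insert_erase h]
  · intro b hb hbv
    simp only [cone]
    rw [if_pos (by simp [h, hbv.symm]), smul_zero]
  · intro h'; exact absurd h h'

lemma cone_not_mem (v : Fin n) (φ : Finset (Fin n) → R) (σ) (h : v ∉ σ) :
    φ σ - cob (cone v φ) σ = sg v σ • cob φ (insert v σ) := by
  unfold cob
  rw [Finset.sum_insert h, Finset.erase_insert h, smul_add, smul_smul, sg_mul_self, one_smul,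
    sub_eq_add_neg, ← Finset.sum_neg_distrib, Finset.smul_sum]
  congr 1
  refine Finset.sum_congr rfl fun u hu => ?_
  have huv : u ≠ v := fun e => h (e ▸ hu)
  have e1 : (insert v σ).erase u = insert v (σ.erase u) :=
    Finset.erase_insert_of_ne huv.symm
  have hv' : v ∉ σ.erase u := by simp [h]
  simp only [cone]
  rw [if_neg hv', e1]
  set ρ := σ.erase u with hρ
  have e2 : σ = insert u ρ := by rw [hρ, Finset.insert_erase hu]
  have huρ : u ∉ ρ := by simp [hρ]
  rw [e2, smul_smul, smul_smul, ← neg_smul]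
  congr 1
  have := sg_anti u v ρ huv huρ hv'
  have h1 := sg_mul_self u ρ
  have h2 := sg_mul_self u (insert v ρ)
  calc -(sg u ρ * sg v ρ) = -(sg v ρ * sg u (insert v ρ)) * (sg u ρ * sg u (insert v ρ)) := by
        linear_combination (-(sg v ρ * sg u ρ) * -h2)
    _ = (sg u ρ * sg v (insert u ρ)) * (sg u ρ * sg u (insert v ρ)) := by rw [this]
    _ = sg v (insert u ρ) * sg u (insert v ρ) := by linear_combination (sg v (insert u ρ) * sg u (insert v ρ)) * h1

/-- support in cardinality d -/
def supp (φ : Finset (Fin n) → R) (d : ℕ) : Finset (Finset (Fin n)) := by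
  classical exact Finset.univ.filter fun s => s.card = d ∧ φ s ≠ 0

lemma mem_supp (φ : Finset (Fin n) → R) (d : ℕ) (s) : s ∈ supp φ d ↔ s.card = d ∧ φ s ≠ 0 := by
  simp [supp]

/-- key expansion counting, one vertex -/
lemma supp_cone_le (φ : Finset (Fin n) → R) (d : ℕ) (v : Fin n) :
    (supp (fun s => φ s - cob (cone v φ) s) d).card ≤
      ((supp (cob φ) (d+1)).filter (fun τ => v ∈ τ)).card := by
  have key : ∀ s ∈ supp (fun s => φ s - cob (cone v φ) s) d, v ∉ s := by
    intro s hs hv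
    rw [mem_supp] at hs
    exact hs.2 (by rw [cone_mem v φ s hv, sub_self])
  refine Finset.card_le_card_of_injOn (fun s => insert v s) ?_ ?_
  · intro s hs
    have hv := key s hs
    have hs' := (mem_supp _ _ _).1 hs
    simp only [Finset.coe_filter, Set.mem_ofPred_eq, mem_supp]
    refine ⟨⟨by rw [Finset.card_insert_of_notMem hv, hs'.1], ?_⟩, by simp⟩
    have := hs'.2
    rw [cone_not_mem v φ s hv] at this
    exact sg_ne _ _ _ this
  · intro s hs t ht hst
    have hs' := key s hs
    have ht' := key t ht
    simp only at hst
    rw [← Finset.erase_insert hs', hst, Finset.erase_insert ht']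

lemma sum_filter_mem (B : Finset (Finset (Fin n))) (k : ℕ) (hB : ∀ τ ∈ B, τ.card = k) :
    ∑ v : Fin n, (B.filter (fun τ => v ∈ τ)).card = k * B.card := by
  simp_rw [Finset.card_filter]
  rw [Finset.sum_comm]
  rw [Finset.sum_congr rfl (g := fun _ => k)]
  · simp [mul_comm]
  · intro τ hτ
    rw [← hB τ hτ]; simp

/-- adjacency -/
def nbr (d : ℕ) (σ : Finset (Fin n)) : Finset (Finset (Fin n)) :=
  Finset.univ.filter fun ρ => ρ.card = d ∧ (σ ∪ ρ).card = d + 1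

/-- Lemma A -/
lemma lemA (φ : Finset (Fin n) → R) (d : ℕ) (U : Finset (Finset (Fin n)))
    (hU : U ⊆ supp φ d) :
    U.card * (n - d) ≤ (supp (cob φ) (d+1)).card + ∑ σ ∈ supp φ d, (nbr d σ ∩ U).card := by
  classical
  set T := supp φ d with hT
  have hTc : ∀ σ ∈ T, σ.card = d := fun σ h => ((mem_supp _ _ _).1 h).1
  -- all pairs
  let P : Finset ((_ : Finset (Fin n)) × Fin n) := U.sigma fun ρ => ρᶜ
  have hP : P.card = U.card * (n - d) := by
    rw [Finset.card_sigma, Finset.sum_const_nat]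
    intro ρ hρ
    rw [Finset.card_compl, hTc ρ (hU hρ)]; simp
  let good : ((_ : Finset (Fin n)) × Fin n) → Prop := fun a =>
    ∀ σ ∈ T, σ ⊆ insert a.2 a.1 → σ = a.1
  rw [← hP, ← Finset.card_filter_add_card_filter_not (s := P) good]
  refine add_le_add ?_ ?_
  · refine Finset.card_le_card_of_injOn (fun a => insert a.2 a.1) ?_ ?_
    · rintro ⟨ρ, v⟩ h
      simp only [Finset.coe_filter, Set.mem_ofPred_eq, P, Finset.mem_sigma, Finset.mem_compl] at h
      obtain ⟨⟨hρ, hv⟩, hg⟩ := h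
      have hρT := hU hρ
      simp only [Finset.mem_coe, mem_supp]
      refine ⟨by rw [Finset.card_insert_of_notMem hv, hTc ρ hρT], ?_⟩
      unfold cob
      rw [Finset.sum_eq_single v, Finset.erase_insert hv]
      · intro h0
        have := ((mem_supp _ _ _).1 hρT).2
        apply this
        calc φ ρ = sg v ρ • (sg v ρ • φ ρ) := by rw [smul_smul, sg_mul_self, one_smul]
          _ = 0 := by rw [h0, smul_zero]
      · intro u hu huv
        have hne : (insert v ρ).erase u ∉ T := by
          intro hmem
          have := hg _ hmem (Finset.erase_subset _ _)
          simp only at this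
          have hv2 : v ∈ (insert v ρ).erase u := by simp [huv.symm]
          rw [this] at hv2
          exact hv hv2
        have : φ ((insert v ρ).erase u) = 0 := by
          by_contra h0
          apply hne
          rw [hT, mem_supp]
          refine ⟨?_, h0⟩
          rw [Finset.card_erase_of_mem hu, Finset.card_insert_of_notMem hv, hTc ρ hρT]; simp
        rw [this, smul_zero]
      · intro h; simp at h
    · rintro ⟨ρ, v⟩ h ⟨ρ', v'⟩ h' heq
      simp only [Finset.coe_filter, Set.mem_ofPred_eq, P, Finset.mem_sigma, Finset.mem_compl] at h h'
      simp only at heq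
      have e : ρ' = ρ := h.2 ρ' (hU h'.1.1) (by rw [heq]; exact Finset.subset_insert _ _)
      subst e
      have : v ∈ insert v' ρ' := by rw [← heq]; simp
      rcases Finset.mem_insert.1 this with e | e
      · subst e; rfl
      · exact absurd e h.1.2
  · rw [← Finset.card_sigma]
    have ex : ∀ a ∈ P.filter (fun a => ¬ good a), ∃ σ, σ ∈ T ∧ σ ⊆ insert a.2 a.1 ∧ σ ≠ a.1 := by
      intro a ha
      have := (Finset.mem_filter.1 ha).2
      simp only [good, not_forall] at this
      obtain ⟨σ, h1, h2, h3⟩ := this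
      exact ⟨σ, h1, h2, h3⟩
    choose! f hf using ex
    have hun : ∀ a ∈ P.filter (fun a => ¬ good a), a.2 ∈ f a ∧ f a ∪ a.1 = insert a.2 a.1 := by
      rintro ⟨ρ, v⟩ ha
      obtain ⟨h1, h2, h3⟩ := hf _ ha
      simp only [Finset.mem_filter, P, Finset.mem_sigma, Finset.mem_compl] at ha
      simp only at h1 h2 h3 ⊢
      have hv : v ∈ f ⟨ρ, v⟩ := by
        by_contra hv
        apply h3
        refine Finset.eq_of_subset_of_card_le ?_ ?_
        · intro x hx
          rcases Finset.mem_insert.1 (h2 hx) with e | e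
          · subst e; exact absurd hx hv
          · exact e
        · rw [hTc _ h1, hTc _ (hU ha.1.1)]
      refine ⟨hv, ?_⟩
      apply Finset.Subset.antisymm
      · exact Finset.union_subset h2 (Finset.subset_insert _ _)
      · exact Finset.insert_subset (Finset.mem_union_left _ hv) Finset.subset_union_right
    refine Finset.card_le_card_of_injOn (fun a => (⟨f a, a.1⟩ : (_ : Finset (Fin n)) × Finset (Fin n))) ?_ ?_
    · rintro ⟨ρ, v⟩ ha
      have ha := Finset.mem_coe.1 ha
      obtain ⟨h1, h2, h3⟩ := hf _ ha
      obtain ⟨h4, h5⟩ := hun _ ha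
      simp only [Finset.mem_filter, P, Finset.mem_sigma, Finset.mem_compl] at ha
      simp only [Finset.coe_sigma, Set.mem_sigma_iff, Finset.mem_coe, nbr, Finset.mem_inter,
        Finset.mem_filter, Finset.mem_univ, true_and]
      refine ⟨h1, ⟨hTc _ (hU ha.1.1), ?_⟩, ha.1.1⟩
      rw [h5]
      simp only
      rw [Finset.card_insert_of_notMem ha.1.2, hTc _ (hU ha.1.1)]
    · rintro ⟨ρ, v⟩ ha ⟨ρ', v'⟩ ha' heq
      have ha := Finset.mem_coe.1 ha
      have ha' := Finset.mem_coe.1 ha'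
      obtain ⟨h4, h5⟩ := hun _ ha
      obtain ⟨h4', h5'⟩ := hun _ ha'
      simp only [Sigma.mk.injEq, heq_eq_eq] at heq
      obtain ⟨e1, e2⟩ := heq
      subst e2
      rw [← e1] at h5'
      rw [h5] at h5'
      simp only at h5'
      simp only [Finset.mem_filter, P, Finset.mem_sigma, Finset.mem_compl] at ha
      have : v ∈ insert v' ρ := by rw [← h5']; simp
      rcases Finset.mem_insert.1 this with e | e
      · subst e; rfl
      · exact absurd e ha.1.2

lemma card_nbr_le (d : ℕ) (σ : Finset (Fin n)) (hσ : σ.card = d) : (nbr d σ).card ≤ d * n := by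
  classical
  have : nbr d σ ⊆ (σ ×ˢ (Finset.univ : Finset (Fin n))).image (fun a => (insert a.2 σ).erase a.1) := by
    intro ρ hρ
    simp only [nbr, Finset.mem_filter, Finset.mem_univ, true_and] at hρ
    obtain ⟨h1, h2⟩ := hρ
    have a1 : (ρ \ σ).card = 1 := by
      have := Finset.card_sdiff_add_card ρ σ
      rw [Finset.union_comm] at this; omega
    have a2 : (σ \ ρ).card = 1 := by
      have := Finset.card_sdiff_add_card σ ρ
      omega
    obtain ⟨v, hv⟩ := Finset.card_eq_one.1 a1
    obtain ⟨u, hu⟩ := Finset.card_eq_one.1 a2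
    have hu' : u ∈ σ \ ρ := by rw [hu]; simp
    have hv' : v ∈ ρ \ σ := by rw [hv]; simp
    simp only [Finset.mem_sdiff] at hu' hv'
    refine Finset.mem_image.2 ⟨(u, v), by simp [hu'.1], ?_⟩
    ext x
    have hx1 : x ∈ ρ \ σ ↔ x = v := by rw [hv]; simp
    have hx2 : x ∈ σ \ ρ ↔ x = u := by rw [hu]; simp
    simp only [Finset.mem_sdiff] at hx1 hx2
    simp only [Finset.mem_erase, Finset.mem_insert]
    by_cases c1 : x ∈ σ <;> by_cases c2 : x ∈ ρ <;> simp_all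
  calc _ ≤ _ := Finset.card_le_card this
    _ ≤ _ := Finset.card_image_le
    _ = d * n := by simp [hσ]

/-- greedy domination -/
lemma greedy (d : ℕ) (T : Finset (Finset (Fin n))) (k : ℝ) (hk : 0 < k) :
    ∃ S : Finset (Finset (Fin n)), S ⊆ T ∧ k * S.card ≤ T.card ∧
      ∀ σ ∈ T, ((nbr d σ ∩ (T \ S.biUnion (nbr d))).card : ℝ) ≤ k := by
  classical
  let Q := T.powerset.filter fun S => k * (S.card : ℝ) ≤ ((T ∩ S.biUnion (nbr d)).card : ℝ)
  have hQ : Q.Nonempty := ⟨∅, by simp [Q]⟩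
  obtain ⟨S, hS, hmax⟩ := Finset.exists_max_image Q Finset.card hQ
  simp only [Q, Finset.mem_filter, Finset.mem_powerset] at hS hmax
  refine ⟨S, hS.1, hS.2.trans (by exact_mod_cast Finset.card_le_card Finset.inter_subset_left), ?_⟩
  intro σ hσ
  by_contra! hlt
  have hσS : σ ∉ S := by
    intro h
    have : nbr d σ ∩ (T \ S.biUnion (nbr d)) = ∅ := by
      ext x
      simp only [Finset.mem_inter, Finset.mem_sdiff, Finset.mem_biUnion]
      constructor
      · rintro ⟨h1, _, h3⟩; exact absurd ⟨σ, h, h1⟩ h3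
      · simp
    rw [this] at hlt
    simp at hlt
    linarith
  have := hmax (insert σ S) ⟨Finset.insert_subset hσ hS.1, ?_⟩
  · rw [Finset.card_insert_of_notMem hσS] at this; omega
  · rw [Finset.card_insert_of_notMem hσS]
    have h2 : (T ∩ S.biUnion (nbr d)).card + (nbr d σ ∩ (T \ S.biUnion (nbr d))).card ≤
        (T ∩ (insert σ S).biUnion (nbr d)).card := by
      rw [← Finset.card_union_of_disjoint]
      · apply Finset.card_le_card
        intro x
        simp only [Finset.mem_union, Finset.mem_inter, Finset.mem_sdiff, Finset.biUnion_insert]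
        tauto
      · rw [Finset.disjoint_left]
        intro x
        simp only [Finset.mem_inter, Finset.mem_sdiff]
        tauto
    have h3 : ((T ∩ S.biUnion (nbr d)).card : ℝ) + (nbr d σ ∩ (T \ S.biUnion (nbr d))).card ≤
        (T ∩ (insert σ S).biUnion (nbr d)).card := by exact_mod_cast h2
    push_cast
    linarith [hS.2]

end MW
end

open MeasureTheory Filter Finset Matrix
noncomputable section
namespace MW

variable {n : ℕ} {G : Type} [AddCommGroup G]

/-- extension by zero -/
def ext0 (K : Finset (Finset (Fin n))) (c : ℕ) (f : Chains K c G) (s : Finset (Fin n)) : G :=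
  if h : s ∈ K ∧ s.card = c then f ⟨s, h⟩ else 0

lemma chainBoundary_eq (K : Finset (Finset (Fin n))) (c : ℕ) (f : Chains K (c+1) G)
    (τ : {s : Finset (Fin n) // s ∈ K ∧ s.card = c}) :
    chainBoundary K c f τ = bd (ext0 K (c+1) f) τ.1 := by
  unfold chainBoundary bd
  rw [← Finset.sum_subset (Finset.subset_univ (τ.1ᶜ))]
  · refine Finset.sum_congr rfl fun v hv => ?_
    have hv : v ∉ τ.1 := by simpa using hv
    by_cases h : insert v τ.1 ∈ K
    · rw [dif_pos ⟨hv, h⟩]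
      unfold ext0
      rw [dif_pos ⟨h, by rw [Finset.card_insert_of_notMem hv, τ.2.2]⟩]
      rfl
    · rw [dif_neg (fun h' => h h'.2)]
      unfold ext0
      rw [dif_neg (fun h' => h h'.1), smul_zero]
  · intro v _ hv
    rw [dif_neg]
    rintro ⟨h, _⟩
    exact hv (by simpa using h)

variable {A : Type} [AddCommGroup A]

/-- pairing -/
def pair (K : Finset (Finset (Fin n))) (c : ℕ) (φ : Finset (Fin n) → (G →+ A)) (f : Chains K c G) : A :=
  ∑ s : {s : Finset (Fin n) // s ∈ K ∧ s.card = c}, φ s.1 (f s)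

lemma pair_eq (K : Finset (Finset (Fin n))) (c : ℕ) (φ : Finset (Fin n) → (G →+ A)) (f : Chains K c G) :
    pair K c φ f = ∑ s ∈ K.filter (fun s => s.card = c), φ s (ext0 K c f s) := by
  unfold pair
  rw [Finset.sum_subtype (p := fun s => s ∈ K ∧ s.card = c) (K.filter (fun s => s.card = c)) (by simp)]
  refine Finset.sum_congr rfl fun s _ => ?_
  unfold ext0
  rw [dif_pos s.2]

lemma pair_adj (K : Finset (Finset (Fin n))) (hK : ∀ τ ∈ K, ∀ v ∈ τ, τ.erase v ∈ K) (c : ℕ)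
    (φ : Finset (Fin n) → (G →+ A)) (f : Chains K (c+1) G) :
    pair K c φ (chainBoundary K c f) = pair K (c+1) (cob φ) f := by
  have h1 : pair K c φ (chainBoundary K c f) =
      ∑ s ∈ K.filter (fun s => s.card = c), ∑ v ∈ sᶜ.filter (fun v => insert v s ∈ K),
        sg v s • φ s (ext0 K (c+1) f (insert v s)) := by
    unfold pair
    rw [Finset.sum_subtype (p := fun s => s ∈ K ∧ s.card = c) (K.filter (fun s => s.card = c)) (by simp)]
    refine Finset.sum_congr rfl fun s _ => ?_
    rw [chainBoundary_eq]
    unfold bd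
    rw [map_sum, Finset.sum_filter_of_ne]
    · refine Finset.sum_congr rfl fun v _ => ?_
      rw [map_zsmul]
    · intro v hv hne
      by_contra h
      apply hne
      unfold ext0
      rw [dif_neg (fun h' => h h'.1), map_zero, smul_zero]
  rw [h1, pair_eq]
  unfold cob
  simp only [AddMonoidHom.finsetSum_apply, AddMonoidHom.coe_smul, Pi.smul_apply]
  rw [Finset.sum_sigma', Finset.sum_sigma']
  refine Finset.sum_bij' (fun a _ => ⟨insert a.2 a.1, a.2⟩) (fun a _ => ⟨a.1.erase a.2, a.2⟩) ?_ ?_ ?_ ?_ ?_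
  · rintro ⟨s, v⟩ h
    simp only [Finset.mem_sigma, Finset.mem_filter, Finset.mem_compl] at h ⊢
    exact ⟨⟨h.2.2, by rw [Finset.card_insert_of_notMem h.2.1, h.1.2]⟩, by simp⟩
  · rintro ⟨s, v⟩ h
    simp only [Finset.mem_sigma, Finset.mem_filter, Finset.mem_compl] at h ⊢
    refine ⟨⟨hK _ h.1.1 _ h.2, by rw [Finset.card_erase_of_mem h.2, h.1.2]; simp⟩, by simp, ?_⟩
    rw [Finset.insert_erase h.2]; exact h.1.1
  · rintro ⟨s, v⟩ h
    simp only [Finset.mem_sigma, Finset.mem_filter, Finset.mem_compl] at h ⊢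
    rw [Finset.erase_insert h.2.1]
  · rintro ⟨s, v⟩ h
    simp only [Finset.mem_sigma, Finset.mem_filter, Finset.mem_compl] at h ⊢
    rw [Finset.insert_erase h.2]
  · rintro ⟨s, v⟩ h
    simp only [Finset.mem_sigma, Finset.mem_filter, Finset.mem_compl] at h ⊢
    rw [Finset.erase_insert h.2.1]

/-- boundary as a hom -/
def bdHom (K : Finset (Finset (Fin n))) (c : ℕ) : Chains K (c+1) G →+ Chains K c G where
  toFun := chainBoundary K c
  map_zero' := by
    funext τ
    simp [chainBoundary]
  map_add' f g := by
    funext τ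
    simp only [chainBoundary, Pi.add_apply]
    rw [← Finset.sum_add_distrib]
    refine Finset.sum_congr rfl fun v _ => ?_
    split
    · simp [smul_add]
    · simp

lemma pair_sub (K : Finset (Finset (Fin n))) (c : ℕ) (φ ψ : Finset (Fin n) → (G →+ A)) (f : Chains K c G) :
    pair K c (fun s => φ s - ψ s) f = pair K c φ f - pair K c ψ f := by
  simp [pair, Finset.sum_sub_distrib]

lemma mem_Y {d : ℕ} (ω : FaceIdx n d → Bool) (s : Finset (Fin n)) :
    s ∈ Ycomplex n d ω ↔ s.card ≤ d ∨ ∃ h : s.card = d + 1, ω ⟨s, h⟩ = true := by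
  simp [Ycomplex]

lemma Y_closed {d : ℕ} (ω : FaceIdx n d → Bool) :
    ∀ τ ∈ Ycomplex n d ω, ∀ v ∈ τ, τ.erase v ∈ Ycomplex n d ω := by
  intro τ hτ v hv
  rw [mem_Y] at *
  left
  rw [Finset.card_erase_of_mem hv]
  rcases hτ with h | ⟨h, _⟩ <;> omega

/-- The obstruction. -/
lemma exists_obstruction (d : ℕ) (hd : 1 ≤ d) (ω : FaceIdx n d → Bool)
    (h : ¬ HomologyZero (Ycomplex n d ω) (d - 1) G) :
    ∃ φ : Finset (Fin n) → (G →+ AddCircle (1:ℚ)), (∀ s, s.card ≠ d → φ s = 0) ∧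
      (supp φ d).Nonempty ∧ n * (supp φ d).card ≤ (d+1) * (supp (cob φ) (d+1)).card ∧
      ∀ τ : FaceIdx n d, τ.1 ∈ supp (cob φ) (d+1) → ω τ = false := by
  classical
  obtain ⟨d, rfl⟩ : ∃ e, d = e + 1 := ⟨d - 1, by omega⟩
  simp only [Nat.add_sub_cancel] at h
  set K := Ycomplex n (d+1) ω with hKdef
  have hK := Y_closed ω
  rw [← hKdef] at hK
  unfold HomologyZero at h
  push Not at h
  obtain ⟨f, hf, hnb⟩ := h
  -- character
  let B : AddSubgroup (Chains K (d+1) G) := (bdHom (G := G) K (d+1)).range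
  have hfB : (QuotientAddGroup.mk f : Chains K (d+1) G ⧸ B) ≠ 0 := by
    rw [Ne, QuotientAddGroup.eq_zero_iff]
    rintro ⟨g, hg⟩
    exact hnb g hg
  obtain ⟨χ0, hχ0⟩ := CharacterModule.exists_character_apply_ne_zero_of_ne_zero hfB
  let χ : Chains K (d+1) G →+ AddCircle (1:ℚ) := AddMonoidHom.comp χ0 (QuotientAddGroup.mk' B)
  have hχf : χ f ≠ 0 := hχ0
  have hχB : ∀ g, χ (chainBoundary K (d+1) g) = 0 := by
    intro g
    have : (QuotientAddGroup.mk' B) (chainBoundary K (d+1) g) = 0 := by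
      rw [QuotientAddGroup.mk'_apply, QuotientAddGroup.eq_zero_iff]
      exact ⟨g, rfl⟩
    show χ0 _ = 0
    rw [this, map_zero]
  let φ0 : Finset (Fin n) → (G →+ AddCircle (1:ℚ)) := fun s =>
    if hs : s ∈ K ∧ s.card = d + 1 then
      χ.comp (AddMonoidHom.single (fun _ : {s : Finset (Fin n) // s ∈ K ∧ s.card = d + 1} => G) ⟨s, hs⟩) else 0
  have hpair : ∀ c, pair K (d+1) φ0 c = χ c := by
    intro c
    conv_rhs => rw [← Finset.univ_sum_single c]
    rw [map_sum]
    unfold pair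
    refine Finset.sum_congr rfl fun s _ => ?_
    simp only [φ0]
    rw [dif_pos s.2]
    rfl
  -- the set of candidates
  let M : Set (Finset (Fin n) → (G →+ AddCircle (1:ℚ))) :=
    {φ | pair K (d+1) φ f ≠ 0 ∧ ∀ τ ∈ K, τ.card = d + 2 → cob φ τ = 0}
  have hM0 : φ0 ∈ M := by
    refine ⟨by rw [hpair]; exact hχf, ?_⟩
    intro τ hτ hτc
    ext x
    let g : Chains K (d+1+1) G := Pi.single ⟨τ, hτ, hτc⟩ x
    have h1 := pair_adj K hK (d+1) φ0 g
    rw [hpair, hχB] at h1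
    unfold pair at h1
    rw [Finset.sum_eq_single (⟨τ, hτ, hτc⟩ : {s : Finset (Fin n) // s ∈ K ∧ s.card = d+1+1})] at h1
    · simp only [g, Pi.single_eq_same] at h1
      rw [← h1]; rfl
    · intro b _ hb
      simp only [g]
      rw [Pi.single_eq_of_ne hb, map_zero]
    · simp
  obtain ⟨φ, hφM, hmin⟩ : ∃ φ ∈ M, ∀ ψ ∈ M, (supp φ (d+1)).card ≤ (supp ψ (d+1)).card := by
    have hne : ((fun φ => (supp φ (d+1)).card) '' M).Nonempty := ⟨_, φ0, hM0, rfl⟩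
    obtain ⟨φ, hφ, he⟩ := Nat.sInf_mem hne
    refine ⟨φ, hφ, fun ψ hψ => ?_⟩
    simp only at he
    rw [he]
    exact Nat.sInf_le ⟨ψ, hψ, rfl⟩
  have hexp : ∀ v : Fin n, (supp φ (d+1)).card ≤ ((supp (cob φ) (d+2)).filter (fun τ => v ∈ τ)).card := by
    intro v
    refine (hmin (fun s => φ s - cob (cone v φ) s) ⟨?_, ?_⟩).trans (supp_cone_le φ (d+1) v)
    · rw [pair_sub, ← pair_adj K hK, hf]
      have : pair K d (cone v φ) (0 : Chains K d G) = 0 := by simp [pair]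
      rw [this, sub_zero]
      exact hφM.1
    · intro τ hτ hτc
      rw [cob_sub, cob_cob, sub_zero]
      exact hφM.2 τ hτ hτc
  have hexp2 : n * (supp φ (d+1)).card ≤ (d+2) * (supp (cob φ) (d+2)).card := by
    rw [← sum_filter_mem (supp (cob φ) (d+2)) (d+2) (fun τ h => ((mem_supp _ _ _).1 h).1)]
    calc n * (supp φ (d+1)).card = ∑ v : Fin n, (supp φ (d+1)).card := by simp
      _ ≤ _ := Finset.sum_le_sum fun v _ => hexp v
  let φ' : Finset (Fin n) → (G →+ AddCircle (1:ℚ)) := fun s => if s.card = d + 1 then φ s else 0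
  have e1 : supp φ' (d+1) = supp φ (d+1) := by
    ext s
    rw [mem_supp, mem_supp]
    refine and_congr_right fun hs => ?_
    simp only [φ', if_pos hs]
  have e2 : supp (cob φ') (d+2) = supp (cob φ) (d+2) := by
    ext s
    rw [mem_supp, mem_supp]
    refine and_congr_right fun hs => ?_
    have : cob φ' s = cob φ s := by
      unfold cob
      refine Finset.sum_congr rfl fun v hv => ?_
      simp only [φ']
      rw [if_pos (by rw [Finset.card_erase_of_mem hv, hs]; simp)]
    rw [this]
  refine ⟨φ', ?_, ?_, ?_, ?_⟩
  · intro s hs; simp only [φ', if_neg hs]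
  · rw [e1]
    by_contra hne
    rw [Finset.not_nonempty_iff_eq_empty] at hne
    apply hφM.1
    unfold pair
    refine Finset.sum_eq_zero fun s _ => ?_
    have : φ s.1 = 0 := by
      by_contra h0
      have : s.1 ∈ supp φ (d+1) := (mem_supp _ _ _).2 ⟨s.2.2, h0⟩
      rw [hne] at this
      simp at this
    rw [this]; rfl
  · rw [e1, e2]; exact hexp2
  · intro τ hτ
    rw [e2, mem_supp] at hτ
    by_contra hω
    apply hτ.2
    apply hφM.2 τ.1 _ τ.2
    rw [hKdef, mem_Y]
    right
    exact ⟨τ.2, by simpa using hω⟩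

/-- An isolated face obstructs vanishing. -/
lemma isolated_obstructs [Nontrivial G] (d : ℕ) (hd : 1 ≤ d) (hn : d < n) (ω : FaceIdx n d → Bool)
    (σ : Finset (Fin n)) (hσ : σ.card = d) (hiso : ∀ τ : FaceIdx n d, σ ⊆ τ.1 → ω τ = false) :
    ¬ HomologyZero (Ycomplex n d ω) (d - 1) G := by
  classical
  obtain ⟨d, rfl⟩ : ∃ e, d = e + 1 := ⟨d - 1, by omega⟩
  simp only [Nat.add_sub_cancel]
  intro h
  obtain ⟨x, hx⟩ := exists_ne (0 : G)
  obtain ⟨v, hv⟩ : ∃ v, v ∉ σ := by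
    by_contra! hall
    have : σ = Finset.univ := by ext; simp [hall]
    rw [this] at hσ; simp at hσ; omega
  set K := Ycomplex n (d+1) ω with hKdef
  let F : Finset (Fin n) → G := fun s => if s = insert v σ then x else 0
  let f : Chains K (d+1) G := fun s => bd F s.1
  have hbd0 : chainBoundary K d f = 0 := by
    funext ρ
    rw [chainBoundary_eq]
    rw [Pi.zero_apply, ← bd_bd F ρ.1]
    unfold bd
    refine Finset.sum_congr rfl fun u hu => ?_
    congr 1
    unfold ext0
    rw [dif_pos]
    · rfl
    · have hu : u ∉ ρ.1 := by simpa using hu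
      have hc : (insert u ρ.1).card = d + 1 := by rw [Finset.card_insert_of_notMem hu, ρ.2.2]
      refine ⟨?_, hc⟩
      exact (mem_Y ω _).2 (Or.inl (by omega))
  obtain ⟨g, hg⟩ := h f hbd0
  have hσK : σ ∈ K := by rw [hKdef, mem_Y]; left; omega
  have h1 := congrFun hg ⟨σ, hσK, hσ⟩
  have h2 : chainBoundary K (d+1) g ⟨σ, hσK, hσ⟩ = 0 := by
    unfold chainBoundary
    refine Finset.sum_eq_zero fun u _ => ?_
    rw [dif_neg]
    rintro ⟨hu, hmem⟩
    simp only at hu hmem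
    rw [hKdef, mem_Y] at hmem
    rcases hmem with hm | ⟨hm, hω⟩
    · rw [Finset.card_insert_of_notMem hu] at hm; omega
    · rw [hiso ⟨_, hm⟩ (Finset.subset_insert _ _)] at hω
      simp at hω
  rw [h2] at h1
  simp only [f] at h1
  unfold bd at h1
  rw [Finset.sum_eq_single v] at h1
  · simp only [F, if_true] at h1
    apply hx
    calc x = sg v σ • (sg v σ • x) := by rw [smul_smul, sg_mul_self, one_smul]
      _ = 0 := by rw [← h1, smul_zero]
  · intro u hu huv
    have hu : u ∉ σ := by simpa using hu
    simp only [F]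
    rw [if_neg, smul_zero]
    intro he
    have : u ∈ insert v σ := by rw [← he]; simp
    simp [huv, hu] at this
  · intro h; simp [hv] at h

lemma finite_dual [Finite G] : Finite (G →+ AddCircle (1:ℚ)) := by
  have hfin : {x : AddCircle (1:ℚ) | (Nat.card G) • x = 0}.Finite := by
    have : 0 < Nat.card G := Nat.card_pos
    exact AddCircle.finite_torsion (1:ℚ) this
  have := hfin.to_subtype
  let Φ : (G →+ AddCircle (1:ℚ)) → (G → {x : AddCircle (1:ℚ) | (Nat.card G) • x = 0}) :=
    fun φ g => ⟨φ g, by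
      show Nat.card G • φ g = 0
      rw [← map_nsmul, card_nsmul_eq_zero', map_zero]⟩
  refine Finite.of_injective Φ ?_
  intro φ ψ h
  ext g
  have := congrFun h g
  exact congrArg Subtype.val this

end MW
end

open MeasureTheory Filter Finset Matrix
noncomputable section
namespace MW

variable {n : ℕ} {G : Type} [AddCommGroup G]

/-- clamp -/
def cl (p : ℝ) : ℝ := max 0 (min p 1)

lemma cl_nonneg (p : ℝ) : 0 ≤ cl p := le_max_left _ _
lemma cl_le_one (p : ℝ) : cl p ≤ 1 := max_le zero_le_one (min_le_right _ _)

instance (p : ℝ) : IsProbabilityMeasure (bernoulliBool p) := by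
  constructor
  simp only [bernoulliBool, Measure.add_apply, Measure.smul_apply, smul_eq_mul,
    measure_univ, mul_one]
  change ENNReal.ofReal (cl p) + ENNReal.ofReal (1 - cl p) = 1
  rw [← ENNReal.ofReal_add (cl_nonneg p) (by linarith [cl_le_one p])]
  simp

lemma bern_false (p : ℝ) : bernoulliBool p {false} = ENNReal.ofReal (1 - cl p) := by
  simp [bernoulliBool, cl]

instance (d : ℕ) (p : ℝ) : IsProbabilityMeasure (YMeasure n d p) := by
  unfold YMeasure; infer_instance

lemma Y_empty (d : ℕ) (p : ℝ) (B : Finset (Finset (Fin n))) (hB : ∀ τ ∈ B, τ.card = d + 1) :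
    YMeasure n d p {ω | ∀ τ : FaceIdx n d, τ.1 ∈ B → ω τ = false} =
      ENNReal.ofReal ((1 - cl p) ^ B.card) := by
  classical
  have e : {ω : FaceIdx n d → Bool | ∀ τ : FaceIdx n d, τ.1 ∈ B → ω τ = false} =
      Set.univ.pi (fun τ : FaceIdx n d => if τ.1 ∈ B then {false} else Set.univ) := by
    ext ω
    simp only [Set.mem_ofPred_eq, Set.mem_univ_pi]
    refine forall_congr' fun τ => ?_
    by_cases h : τ.1 ∈ B <;> simp [h]
  rw [e, YMeasure, Measure.pi_pi]
  have h1 : ∀ τ : FaceIdx n d, bernoulliBool p (if τ.1 ∈ B then {false} else Set.univ) =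
      if τ.1 ∈ B then ENNReal.ofReal (1 - cl p) else 1 := by
    intro τ
    split_ifs
    · exact bern_false p
    · exact measure_univ
  simp_rw [h1]
  rw [Finset.prod_ite, Finset.prod_const, Finset.prod_const_one, mul_one,
    ENNReal.ofReal_pow (by linarith [cl_le_one p])]
  congr 1
  refine Finset.card_bij (fun a _ => a.1) ?_ ?_ ?_
  · intro a ha; simpa using ha
  · intro a _ b _ h; exact Subtype.ext h
  · intro b hb; exact ⟨⟨b, hB b hb⟩, by simpa using hb, rfl⟩

/-- faces of cardinality d -/
def faces (n d : ℕ) : Finset (Finset (Fin n)) := Finset.univ.filter fun s => s.card = d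

lemma mem_faces (d : ℕ) (s : Finset (Fin n)) : s ∈ faces n d ↔ s.card = d := by simp [faces]

lemma card_faces (n d : ℕ) : (faces n d).card = n.choose d := by
  have : faces n d = Finset.powersetCard d Finset.univ := by
    ext s; simp [faces, Finset.mem_powersetCard]
  rw [this]; simp

lemma card_faces_le (n d : ℕ) : ((faces n d).card : ℝ) ≤ (n : ℝ) ^ d := by
  rw [card_faces]; exact_mod_cast Nat.choose_le_pow n d

lemma supp_subset_faces {R : Type} [AddCommGroup R] (φ : Finset (Fin n) → R) (d : ℕ) :
    supp φ d ⊆ faces n d := fun s hs => (mem_faces d s).2 ((mem_supp _ _ _).1 hs).1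

lemma sum_powerset_pow {α : Type} [DecidableEq α] (s : Finset α) (a : ℝ) :
    ∑ t ∈ s.powerset, a ^ t.card = (1 + a) ^ s.card := by
  have := Finset.sum_pow_mul_eq_add_pow a 1 s
  simp only [one_pow, mul_one] at this
  rw [this, add_comm]

lemma one_add_pow_le (a : ℝ) (ha : 0 ≤ a) (N : ℕ) : (1 + a) ^ N ≤ Real.exp (N * a) := by
  rw [Real.exp_nat_mul]
  exact pow_le_pow_left₀ (by linarith) (by linarith [Real.add_one_le_exp a]) N

lemma bad_le [Finite G] (d : ℕ) (hd : 1 ≤ d) (p : ℝ) (W : Finset (Finset (Fin n)) → ℝ)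
    (hW : ∀ T, 0 ≤ W T)
    (hb : ∀ φ : Finset (Fin n) → (G →+ AddCircle (1:ℚ)), (supp φ d).Nonempty →
      n * (supp φ d).card ≤ (d+1) * (supp (cob φ) (d+1)).card →
      (1 - cl p) ^ (supp (cob φ) (d+1)).card ≤ W (supp φ d)) :
    YMeasure n d p {ω | ¬ HomologyZero (Ycomplex n d ω) (d - 1) G} ≤
      ENNReal.ofReal (∑ T ∈ (faces n d).powerset.filter (fun T => T.Nonempty),
        (Nat.card (G →+ AddCircle (1:ℚ)) : ℝ) ^ T.card * W T) := by
  classical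
  have := finite_dual (G := G)
  let R := G →+ AddCircle (1:ℚ)
  let : Fintype R := Fintype.ofFinite _
  let Φ : Finset (Finset (Fin n) → R) := Finset.univ.filter fun φ =>
    (∀ s, s.card ≠ d → φ s = 0) ∧
      (supp φ d).Nonempty ∧ n * (supp φ d).card ≤ (d+1) * (supp (cob φ) (d+1)).card
  have hsub : {ω | ¬ HomologyZero (Ycomplex n d ω) (d - 1) G} ⊆
      ⋃ φ ∈ Φ, {ω | ∀ τ : FaceIdx n d, τ.1 ∈ supp (cob φ) (d+1) → ω τ = false} := by
    intro ω hω
    obtain ⟨φ, h1, h2, h3, h4⟩ := exists_obstruction d hd ω hω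
    simp only [Set.mem_iUnion]
    exact ⟨φ, by simp only [Φ, Finset.mem_filter, Finset.mem_univ, true_and]; exact ⟨h1, h2, h3⟩, h4⟩
  calc _ ≤ _ := measure_mono hsub
    _ ≤ ∑ φ ∈ Φ, YMeasure n d p {ω | ∀ τ : FaceIdx n d, τ.1 ∈ supp (cob φ) (d+1) → ω τ = false} :=
      measure_biUnion_finset_le _ _
    _ ≤ ∑ φ ∈ Φ, ENNReal.ofReal (W (supp φ d)) := by
      refine Finset.sum_le_sum fun φ hφ => ?_
      simp only [Φ, Finset.mem_filter, Finset.mem_univ, true_and] at hφ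
      rw [Y_empty d p _ (fun τ h => ((mem_supp _ _ _).1 h).1)]
      exact ENNReal.ofReal_le_ofReal (hb φ hφ.2.1 hφ.2.2)
    _ = ENNReal.ofReal (∑ φ ∈ Φ, W (supp φ d)) := by
      rw [ENNReal.ofReal_sum_of_nonneg (fun φ _ => hW _)]
    _ ≤ _ := by
      refine ENNReal.ofReal_le_ofReal ?_
      rw [← Finset.sum_fiberwise_of_maps_to (s := Φ) (t := (faces n d).powerset.filter (fun T => T.Nonempty))
        (g := fun φ => supp φ d)]
      · refine Finset.sum_le_sum fun T hT => ?_
        rw [Finset.sum_congr rfl (g := fun _ => W T)]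
        · rw [Finset.sum_const, nsmul_eq_mul]
          refine mul_le_mul_of_nonneg_right ?_ (hW T)
          have : (Φ.filter (fun φ => supp φ d = T)).card ≤ Fintype.card (T → R) := by
            rw [← Finset.card_univ]
            refine Finset.card_le_card_of_injOn (fun φ t => φ t.1) (fun _ _ => by simp) ?_
            intro φ hφ ψ hψ h
            simp only [Finset.coe_filter, Set.mem_ofPred_eq, Φ, Finset.mem_filter, Finset.mem_univ, true_and] at hφ hψ
            funext s
            by_cases hs : s ∈ T
            · exact congrFun h ⟨s, hs⟩
            · have key : ∀ χ : Finset (Fin n) → R, (∀ s, s.card ≠ d → χ s = 0) → supp χ d = T → χ s = 0 := by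
                intro χ h1 h2
                by_contra h0
                apply hs
                rw [← h2, mem_supp]
                refine ⟨?_, h0⟩
                by_contra hc
                exact h0 (h1 s hc)
              rw [key φ hφ.1.1 hφ.2, key ψ hψ.1.1 hψ.2]
          rw [Fintype.card_fun, Fintype.card_coe, ← Nat.card_eq_fintype_card] at this
          exact_mod_cast this
        · intro φ hφ
          rw [(Finset.mem_filter.1 hφ).2]
      · intro φ hφ
        simp only [Φ, Finset.mem_filter, Finset.mem_univ, true_and] at hφ
        simp only [Finset.mem_filter, Finset.mem_powerset]
        exact ⟨supp_subset_faces φ d, hφ.2.1⟩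

lemma large_sum (d : ℕ) (k ζ a s : ℝ) (hζ : 0 ≤ ζ) (ha : 0 ≤ a)
    (S : Finset (Finset (Fin n)) → Finset (Finset (Fin n)))
    (hS : ∀ T, S T ⊆ T ∧ k * (S T).card ≤ T.card) :
    ∑ T ∈ (faces n d).powerset.filter (fun T => s < (T.card : ℝ)),
      a ^ (T \ (S T).biUnion (nbr d)).card * Real.exp (-ζ * T.card) ≤
    Real.exp (-ζ * s / 2) * (Real.exp ((faces n d).card * (2 ^ (d * n) * Real.exp (-ζ * k / 2))) *
      Real.exp ((faces n d).card * a)) := by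
  classical
  set x := Real.exp (-ζ * k / 2) with hx
  have hx0 : 0 ≤ x := (Real.exp_pos _).le
  let I : Finset ((_ : Finset (Finset (Fin n))) × (Finset (Finset (Fin n)) × Finset (Finset (Fin n)))) :=
    (faces n d).powerset.sigma fun S => (S.biUnion (nbr d)).powerset ×ˢ (faces n d).powerset
  let v : ((_ : Finset (Finset (Fin n))) × (Finset (Finset (Fin n)) × Finset (Finset (Fin n)))) → ℝ :=
    fun i => Real.exp (-ζ * s / 2) * (x ^ i.1.card * a ^ i.2.2.card)
  let g : Finset (Finset (Fin n)) → ((_ : Finset (Finset (Fin n))) × (Finset (Finset (Fin n)) × Finset (Finset (Fin n)))) :=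
    fun T => ⟨S T, T ∩ (S T).biUnion (nbr d), T \ (S T).biUnion (nbr d)⟩
  have hg : Function.Injective g := by
    intro T T' h
    have h1 : (g T).2.1 ∪ (g T).2.2 = T := by simp only [g]; rw [Finset.union_comm, Finset.sdiff_union_inter]
    have h2 : (g T').2.1 ∪ (g T').2.2 = T' := by simp only [g]; rw [Finset.union_comm, Finset.sdiff_union_inter]
    rw [← h1, ← h2, h]
  calc _ ≤ ∑ T ∈ (faces n d).powerset.filter (fun T => s < (T.card : ℝ)), v (g T) := by
        refine Finset.sum_le_sum fun T hT => ?_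
        simp only [Finset.mem_filter] at hT
        simp only [v, g]
        rw [hx, ← Real.exp_nat_mul, ← mul_assoc, ← Real.exp_add, mul_comm]
        refine mul_le_mul_of_nonneg_right ?_ (by positivity)
        apply Real.exp_le_exp.2
        have h1 := (hS T).2
        have h2 := mul_le_mul_of_nonneg_left h1 hζ
        have h3 := mul_le_mul_of_nonneg_left hT.2.le hζ
        nlinarith
    _ = ∑ i ∈ ((faces n d).powerset.filter (fun T => s < (T.card : ℝ))).image g, v i := by
        rw [Finset.sum_image (fun _ _ _ _ h => hg h)]
    _ ≤ ∑ i ∈ I, v i := by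
        refine Finset.sum_le_sum_of_subset_of_nonneg ?_ ?_
        · intro i hi
          obtain ⟨T, hT, rfl⟩ := Finset.mem_image.1 hi
          simp only [Finset.mem_filter, Finset.mem_powerset] at hT
          simp only [I, g, Finset.mem_sigma, Finset.mem_product, Finset.mem_powerset]
          exact ⟨(hS T).1.trans hT.1, Finset.inter_subset_right, Finset.sdiff_subset.trans hT.1⟩
        · intro i _ _
          simp only [v]; positivity
    _ = Real.exp (-ζ * s / 2) * ((∑ S ∈ (faces n d).powerset, x ^ S.card * 2 ^ (S.biUnion (nbr d)).card) *
          (1 + a) ^ (faces n d).card) := by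
        simp only [I, v]
        rw [Finset.sum_sigma, Finset.sum_mul, Finset.mul_sum]
        refine Finset.sum_congr rfl fun S _ => ?_
        rw [Finset.sum_product]
        simp only
        simp_rw [← Finset.mul_sum]
        rw [sum_powerset_pow, Finset.sum_const, Finset.card_powerset, nsmul_eq_mul]
        push_cast
        ring
    _ ≤ _ := by
        refine mul_le_mul_of_nonneg_left ?_ (Real.exp_pos _).le
        refine mul_le_mul ?_ (one_add_pow_le a ha _) (by positivity) (Real.exp_pos _).le
        refine le_trans ?_ (one_add_pow_le (2 ^ (d * n) * x) (by positivity) _)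
        rw [← sum_powerset_pow]
        refine Finset.sum_le_sum fun S hS => ?_
        rw [mul_pow, mul_comm]
        refine mul_le_mul_of_nonneg_right ?_ (by positivity)
        rw [← pow_mul]
        refine pow_le_pow_right₀ (by norm_num) ?_
        rw [mul_comm]
        refine Finset.card_biUnion_le_card_mul _ _ _ fun σ hσ => ?_
        exact card_nbr_le d σ ((mem_faces d σ).1 (Finset.mem_powerset.1 hS hσ))

end MW
end

open MeasureTheory Filter Finset Matrix
noncomputable section
namespace MW

variable {n : ℕ} {G : Type} [AddCommGroup G]

lemma large_arith (d n b m u : ℝ) (hd : 1 ≤ d) (hn : 8 * (d+1) * d^2 ≤ n) (hm : 0 ≤ m) (hu : 0 ≤ u) (hum : u ≤ m)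
    (h1 : n * m ≤ (d+1) * b) (h2 : u * (n - d) ≤ b + m * (n / (4 * d * (d+1)))) :
    n * ((d - 1/2) * u + m / (8 * (d+1))) ≤ d * b := by
  have hd1 : 0 < d + 1 := by linarith
  set c := m / (8 * (d+1)) with hc
  have hcm : m = 8 * (d+1) * c := by rw [hc]; field_simp
  have hc0 : 0 ≤ c := by rw [hc]; positivity
  have h3 : m * (n / (4 * d * (d+1))) * d = 2 * n * c := by rw [hcm]; field_simp; ring
  have h4 : 8 * n * c ≤ b := by
    have : (d+1) * (8 * n * c) ≤ (d+1) * b := by rw [hcm] at h1; linarith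
    exact le_of_mul_le_mul_left this hd1
  have hn0 : 0 ≤ n := le_trans (by positivity) hn
  have hk0 : 0 ≤ m * (n / (4 * d * (d+1))) := by positivity
  set M := m * (n / (4 * d * (d+1))) with hM
  -- (d-1/2) * h2
  have h5 : (d - 1/2) * (u * (n - d)) ≤ (d - 1/2) * (b + M) :=
    mul_le_mul_of_nonneg_left h2 (by linarith)
  have h6 : (d - 1/2) * M ≤ 2 * n * c := by rw [← h3]; nlinarith
  have h7 : (d - 1/2) * (u * d) ≤ n * c := by
    calc (d - 1/2) * (u * d) ≤ d * (u * d) := by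
          apply mul_le_mul_of_nonneg_right (by linarith) (by positivity)
      _ ≤ d * (m * d) := by gcongr
      _ = (8 * (d+1) * d^2) * c := by rw [hcm]; ring
      _ ≤ n * c := by gcongr
  nlinarith

lemma part1_bound [Finite G] (d : ℕ) (hd : 1 ≤ d) (p q ζ : ℝ)
    (hn : 8 * ((d:ℝ)+1) * d^2 ≤ n)
    (hq : d * Real.log n / n ≤ q) (hp : 1 - cl p ≤ Real.exp (-q))
    (hζ : ζ = Real.log n / (8 * (d+1)) - Real.log (Nat.card (G →+ AddCircle (1:ℚ)))) (hζ0 : 0 ≤ ζ) :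
    YMeasure n d p {ω | ¬ HomologyZero (Ycomplex n d ω) (d - 1) G} ≤
      ENNReal.ofReal (
        (Real.exp ((faces n d).card * (Nat.card (G →+ AddCircle (1:ℚ)) *
            Real.exp (-q * (n - d - Real.sqrt n)))) - 1) +
        Real.exp (-ζ * Real.sqrt n / 2) * (Real.exp ((faces n d).card * (2 ^ (d * n) *
            Real.exp (-ζ * (n / (4 * d * (d+1))) / 2))) *
          Real.exp ((faces n d).card * Real.exp (-(Real.log n * (d - 1/2)))))) := by
  classical
  have := finite_dual (G := G)
  set r := Nat.card (G →+ AddCircle (1:ℚ)) with hr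
  have hr1 : 1 ≤ r := Nat.card_pos
  have hr0 : (0:ℝ) < r := by exact_mod_cast hr1
  have hd' : (1:ℝ) ≤ d := by exact_mod_cast hd
  have hnpos : (0:ℝ) < n := lt_of_lt_of_le (by positivity) hn
  have hn1 : (1:ℝ) ≤ n := by
    have : 0 < n := by exact_mod_cast hnpos
    exact_mod_cast this
  have hL : 0 ≤ Real.log n := Real.log_nonneg hn1
  have hq0 : 0 ≤ q := le_trans (by positivity) hq
  set L := Real.log n
  set s := Real.sqrt n
  set k : ℝ := n / (4 * d * (d+1)) with hk
  have hk0 : 0 < k := by positivity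
  choose S hS1 hS2 hS3 using fun T : Finset (Finset (Fin n)) => greedy d T k hk0
  set a := Real.exp (-(L * (d - 1/2))) with ha
  set x := Real.exp (-q * (n - d - s)) with hx
  let u : Finset (Finset (Fin n)) → ℕ := fun T => (T \ (S T).biUnion (nbr d)).card
  let W : Finset (Finset (Fin n)) → ℝ := fun T =>
    if (T.card : ℝ) ≤ s then x ^ T.card else a ^ (u T) * Real.exp (-(L / (8 * (d+1))) * T.card)
  have hW : ∀ T, 0 ≤ W T := by
    intro T; simp only [W]; split_ifs <;> positivity
  refine (bad_le d hd p W hW ?_).trans (ENNReal.ofReal_le_ofReal ?_)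
  · intro φ hne hexp
    set T := supp φ d with hT
    set b := (supp (cob φ) (d+1)).card with hb
    have hexp' : (n:ℝ) * T.card ≤ (d+1) * b := by exact_mod_cast hexp
    have hle : (1 - cl p) ^ b ≤ Real.exp (-q * b) := by
      rw [mul_comm, Real.exp_nat_mul]
      exact pow_le_pow_left₀ (by linarith [cl_le_one p]) hp b
    refine hle.trans ?_
    have hsub : ((n:ℝ) - d) ≤ ((n - d : ℕ) : ℝ) := by
      have : n ≤ (n - d) + d := by omega
      have : (n:ℝ) ≤ ((n - d : ℕ) : ℝ) + d := by exact_mod_cast this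
      linarith
    simp only [W]
    split_ifs with hs
    · rw [hx, ← Real.exp_nat_mul]
      apply Real.exp_le_exp.2
      have h1 := lemA φ d T (Finset.Subset.refl _)
      have h2 : ∑ σ ∈ T, (nbr d σ ∩ T).card ≤ T.card * T.card := by
        calc _ ≤ ∑ σ ∈ T, T.card := Finset.sum_le_sum fun σ _ => Finset.card_le_card Finset.inter_subset_right
          _ = _ := by simp
      have h3 : T.card * (n - d) ≤ b + T.card * T.card := by
        rw [← hT] at h1; omega
      have h3' : (T.card : ℝ) * ((n - d : ℕ) : ℝ) ≤ b + T.card * T.card := by exact_mod_cast h3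
      have hT0 : (0:ℝ) ≤ T.card := by positivity
      have h4 : (T.card : ℝ) * (n - d - s) ≤ b := by nlinarith
      nlinarith
    · rw [ha, ← Real.exp_nat_mul, ← Real.exp_add]
      apply Real.exp_le_exp.2
      have h1 := lemA φ d (T \ (S T).biUnion (nbr d)) Finset.sdiff_subset
      rw [← hT, ← hb] at h1
      have h2 : ((∑ σ ∈ T, (nbr d σ ∩ (T \ (S T).biUnion (nbr d))).card : ℕ) : ℝ) ≤ T.card * k := by
        push_cast
        calc _ ≤ ∑ σ ∈ T, k := Finset.sum_le_sum fun σ h => hS3 T σ h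
          _ = _ := by simp
      have h1' : (u T : ℝ) * ((n - d : ℕ) : ℝ) ≤ b +
          ((∑ σ ∈ T, (nbr d σ ∩ (T \ (S T).biUnion (nbr d))).card : ℕ) : ℝ) := by exact_mod_cast h1
      have hu0 : (0:ℝ) ≤ u T := by positivity
      have h3 : (u T : ℝ) * (n - d) ≤ b + T.card * k := by nlinarith
      have hum : (u T : ℝ) ≤ T.card := by
        exact_mod_cast Finset.card_le_card Finset.sdiff_subset
      have key := large_arith d n b T.card (u T) hd' hn (by positivity) hu0 hum hexp' h3
      have h5 : L * ((d - 1/2) * u T + T.card / (8 * (d+1))) ≤ q * b := by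
        calc L * ((d - 1/2) * u T + T.card / (8 * (d+1)))
            = L / n * (n * ((d - 1/2) * u T + T.card / (8 * (d+1)))) := by field_simp
          _ ≤ L / n * (d * b) := by gcongr
          _ = (d * L / n) * b := by ring
          _ ≤ q * b := by gcongr
      have e : L / (8 * ((d:ℝ)+1)) * T.card = L * (T.card / (8 * (d+1))) := by ring
      linarith
  · have hterm : ∀ T, (r:ℝ) ^ T.card * W T ≤ (r * x) ^ T.card +
        if s < (T.card : ℝ) then a ^ (u T) * Real.exp (-ζ * T.card) else 0 := by
      intro T
      simp only [W]
      by_cases h : (T.card : ℝ) ≤ s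
      · rw [if_pos h, if_neg (not_lt.2 h), mul_pow, add_zero]
      · rw [if_neg h, if_pos (not_le.1 h)]
        have : (r:ℝ) ^ T.card * (a ^ (u T) * Real.exp (-(L / (8 * (d+1))) * T.card)) =
            a ^ (u T) * Real.exp (-ζ * T.card) := by
          have e1 : (r:ℝ) ^ T.card = Real.exp (T.card * Real.log r) := by
            rw [Real.exp_nat_mul, Real.exp_log hr0]
          rw [e1, mul_left_comm, ← Real.exp_add, hζ]
          congr 2; ring
        rw [this]
        have : 0 ≤ (r * x) ^ T.card := by positivity
        linarith
    calc _ ≤ ∑ T ∈ (faces n d).powerset.filter (fun T => T.Nonempty), ((r * x) ^ T.card +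
        if s < (T.card : ℝ) then a ^ (u T) * Real.exp (-ζ * T.card) else 0) :=
          Finset.sum_le_sum fun T _ => hterm T
      _ = ∑ T ∈ (faces n d).powerset.filter (fun T => T.Nonempty), (r * x) ^ T.card +
          ∑ T ∈ (faces n d).powerset.filter (fun T => T.Nonempty),
            (if s < (T.card : ℝ) then a ^ (u T) * Real.exp (-ζ * T.card) else 0) := Finset.sum_add_distrib
      _ ≤ _ := by
        refine add_le_add ?_ ?_
        · have hE : (faces n d).powerset.filter (fun T => T.Nonempty) = (faces n d).powerset.erase ∅ := by
            ext T
            simp only [Finset.mem_filter, Finset.mem_erase, Finset.nonempty_iff_ne_empty]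
            tauto
          have h1 := Finset.sum_erase_add (faces n d).powerset (fun T => ((r:ℝ) * x) ^ T.card)
            (Finset.empty_mem_powerset _)
          rw [sum_powerset_pow] at h1
          simp only [Finset.card_empty, pow_zero] at h1
          have h2 := one_add_pow_le (r * x) (by positivity) (faces n d).card
          rw [hE]; linarith
        · refine le_trans ?_ (large_sum d k ζ a s hζ0 (by positivity) S (fun T => ⟨hS1 T, hS2 T⟩))
          rw [Finset.sum_filter (p := fun T : Finset (Finset (Fin n)) => s < (T.card : ℝ))]
          refine Finset.sum_le_sum_of_subset_of_nonneg (Finset.filter_subset _ _) ?_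
          intro T _ _
          split_ifs <;> positivity

end MW
end

open MeasureTheory Filter Finset Matrix
noncomputable section
namespace MW

variable {G : Type} [AddCommGroup G]


lemma log_div_sqrt : Tendsto (fun n : ℕ => Real.log n / Real.sqrt n) atTop (nhds 0) := by
  have h := (isLittleO_log_rpow_atTop (r := 1/2) (by norm_num)).tendsto_div_nhds_zero
  have h2 := h.comp tendsto_natCast_atTop_atTop
  refine h2.congr fun n => ?_
  simp [Real.sqrt_eq_rpow]

lemma log_nat_atTop : Tendsto (fun n : ℕ => Real.log n) atTop atTop :=
  Real.tendsto_log_atTop.comp tendsto_natCast_atTop_atTop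

lemma sqrt_nat_atTop : Tendsto (fun n : ℕ => Real.sqrt n) atTop atTop :=
  Real.tendsto_sqrt_atTop.comp tendsto_natCast_atTop_atTop

lemma min_atTop (w : ℕ → ℝ) (hw : Tendsto w atTop atTop) :
    Tendsto (fun n : ℕ => min (w n) (Real.log n)) atTop atTop := by
  rw [tendsto_atTop] at *
  intro b
  filter_upwards [hw b, (tendsto_atTop.1 log_nat_atTop) b] with n h1 h2
  exact le_min h1 h2

lemma part1_event [Finite G] (d : ℕ) (hd : 1 ≤ d) (w : ℕ → ℝ) (hw : Tendsto w atTop atTop) (p : ℕ → ℝ)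
    (hp : ∀ n : ℕ, (d * Real.log n + w n) / n ≤ p n) :
    ∀ᶠ n : ℕ in atTop, YMeasure n d (p n) {ω | ¬ HomologyZero (Ycomplex n d ω) (d - 1) G} ≤
      ENNReal.ofReal ((Real.exp (Nat.card (G →+ AddCircle (1:ℚ)) *
        Real.exp (1 - min (w n) (Real.log n))) - 1) + Real.exp (1 - Real.sqrt n)) := by
  have := finite_dual (G := G)
  have hd' : (1:ℝ) ≤ d := by exact_mod_cast hd
  have hd1 : (0:ℝ) < d + 1 := by positivity
  set r := Nat.card (G →+ AddCircle (1:ℚ)) with hr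
  have hr1 : 1 ≤ r := Nat.card_pos
  set c : ℝ := 1 / (8 * d * (d+1)) with hc
  have hc0 : 0 < c := by positivity
  have e1 := (tendsto_atTop.1 (min_atTop w hw)) 0
  have e2 := (tendsto_atTop.1 log_nat_atTop) (8 * (d+1) * (max 4 (2 * d / c) + Real.log r))
  have e3 := (tendsto_atTop.1 (tendsto_natCast_atTop_atTop (R := ℝ))) (8 * ((d:ℝ)+1) * d^2)
  have e4 : ∀ᶠ n : ℕ in atTop, Real.log n / Real.sqrt n < 1 / ((d+1)^2) :=
    log_div_sqrt.eventually (gt_mem_nhds (by positivity))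
  filter_upwards [e1, e2, e3, e4] with n h1 h2 h3 h4
  set L := Real.log n with hL
  set w' := min (w n) L with hw'
  set q := (d * L + w') / n with hq
  have hnpos : (0:ℝ) < n := lt_of_lt_of_le (by positivity) h3
  have hn1 : (1:ℝ) ≤ n := by
    have : 0 < n := by exact_mod_cast hnpos
    exact_mod_cast this
  have hL0 : 0 ≤ L := Real.log_nonneg hn1
  have hLn : L ≤ n := (Real.log_le_sub_one_of_pos hnpos).trans (by linarith)
  have hpowexp : (n:ℝ) ^ d = Real.exp (d * L) := by
    rw [Real.exp_nat_mul, Real.exp_log hnpos]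
  have hs1 : 1 ≤ Real.sqrt n := Real.one_le_sqrt.2 hn1
  have hss : Real.sqrt n * Real.sqrt n = n := Real.mul_self_sqrt hnpos.le
  set s := Real.sqrt n with hs
  have hN : ((faces n d).card : ℝ) ≤ Real.exp (d * L) := hpowexp ▸ card_faces_le n d
  set ζ := L / (8 * (d+1)) - Real.log r with hζ
  have hζm : max 4 (2 * d / c) ≤ ζ := by
    have : (max 4 (2 * d / c) + Real.log r) ≤ L / (8 * (d+1)) := by
      rw [le_div_iff₀ (by positivity)]; linarith
    linarith
  have hζ4 : 4 ≤ ζ := (le_max_left _ _).trans hζm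
  have hζc : 2 * d ≤ ζ * c := by
    have := (le_max_right 4 (2 * d / c)).trans hζm
    rwa [div_le_iff₀ hc0] at this
  have hqp : q ≤ p n := le_trans (by rw [hq]; gcongr; exact min_le_left _ _) (hp n)
  have hcl : 1 - cl (p n) ≤ Real.exp (-q) := by
    unfold cl
    rcases le_total (p n) 1 with h | h
    · rw [min_eq_left h]
      have a1 := le_max_right 0 (p n)
      have a2 := Real.add_one_le_exp (-q)
      linarith
    · rw [min_eq_right h]
      have a2 := Real.exp_pos (-q)
      simp; linarith
  refine (part1_bound d hd (p n) q ζ h3 ?_ hcl hζ (by linarith)).trans (ENNReal.ofReal_le_ofReal ?_)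
  · rw [hq]; gcongr; linarith
  refine add_le_add ?_ ?_
  · refine sub_le_sub_right (Real.exp_le_exp.2 ?_) _
    rw [mul_left_comm]
    refine mul_le_mul_of_nonneg_left ?_ (by positivity)
    calc ((faces n d).card : ℝ) * Real.exp (-q * (n - d - s)) ≤ Real.exp (d * L) * Real.exp (-q * (n - d - s)) := by
          gcongr
      _ = Real.exp (d * L + -q * (n - d - s)) := by rw [Real.exp_add]
      _ ≤ Real.exp (1 - w') := by
          apply Real.exp_le_exp.2
          have hqn : q * n = d * L + w' := by rw [hq]; field_simp
          have hw'L : w' ≤ L := min_le_right _ _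
          have hqs : q * (d + s) ≤ 1 := by
            have a1 : q * (d + s) ≤ ((d+1) * L / n) * ((d+1) * s) := by
              have b1 : q ≤ (d+1) * L / n := by rw [hq]; gcongr; linarith
              have b2 : d + s ≤ (d+1) * s := by nlinarith
              have b3 : 0 ≤ (d+1) * L / n := by positivity
              exact mul_le_mul b1 b2 (by positivity) b3
            have a2 : ((d+1) * L / n) * ((d+1) * s) = (d+1)^2 * (L / s) := by
              rw [← hss]; field_simp
            have a3 : ((d:ℝ)+1)^2 * (L / s) ≤ (d+1)^2 * (1 / (d+1)^2) := by gcongr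
            have a4 : ((d:ℝ)+1)^2 * (1 / (d+1)^2) = 1 := by field_simp
            linarith
          nlinarith
  · rw [← Real.exp_add, ← Real.exp_add]
    apply Real.exp_le_exp.2
    have t1 : ((faces n d).card : ℝ) * Real.exp (-(L * (d - 1/2))) ≤ s := by
      calc _ ≤ Real.exp (d * L) * Real.exp (-(L * (d - 1/2))) := by gcongr
        _ = Real.exp (L / 2) := by rw [← Real.exp_add]; congr 1; ring
        _ = s := by
          rw [hs, Real.sqrt_eq_rpow, Real.rpow_def_of_pos hnpos]; congr 1; ring
    have t2 : ((faces n d).card : ℝ) * (2 ^ (d * n) * Real.exp (-ζ * (n / (4 * d * (d+1))) / 2)) ≤ 1 := by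
      have b1 : (2:ℝ) ^ (d * n) ≤ Real.exp (d * n) := by
        have : (2:ℝ) ≤ Real.exp 1 := by linarith [Real.add_one_le_exp (1:ℝ)]
        calc (2:ℝ) ^ (d * n) ≤ (Real.exp 1) ^ (d * n) := by gcongr
          _ = Real.exp (d * n) := by rw [← Real.exp_nat_mul]; push_cast; rw [mul_one]
      calc _ ≤ Real.exp (d * L) * (Real.exp (d * n) * Real.exp (-ζ * (n / (4 * d * (d+1))) / 2)) := by gcongr
        _ = Real.exp (d * L + (d * n + -ζ * (n / (4 * d * (d+1))) / 2)) := by rw [Real.exp_add, Real.exp_add]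
        _ ≤ Real.exp 0 := by
          apply Real.exp_le_exp.2
          have : -ζ * (n / (4 * d * (d+1))) / 2 = - (ζ * c) * n := by rw [hc]; field_simp; ring
          rw [this]
          nlinarith
        _ = 1 := Real.exp_zero
    have hz : 4 * s ≤ ζ * s := mul_le_mul_of_nonneg_right hζ4 (by linarith)
    have e : -ζ * s / 2 = -(ζ * s) / 2 := by ring
    rw [← hs, ← hL]
    linarith

lemma part1_err (r : ℕ) (w : ℕ → ℝ) (hw : Tendsto w atTop atTop) :
    Tendsto (fun n : ℕ => (Real.exp (r * Real.exp (1 - min (w n) (Real.log n))) - 1) +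
      Real.exp (1 - Real.sqrt n)) atTop (nhds 0) := by
  have h1 : Tendsto (fun n : ℕ => Real.exp (1 - min (w n) (Real.log n))) atTop (nhds 0) := by
    refine Real.tendsto_exp_atBot.comp ?_
    simp_rw [sub_eq_add_neg]
    exact tendsto_atBot_add_const_left _ _ (tendsto_neg_atTop_atBot.comp (min_atTop w hw))
  have h2 : Tendsto (fun n : ℕ => Real.exp (1 - Real.sqrt n)) atTop (nhds 0) := by
    refine Real.tendsto_exp_atBot.comp ?_
    simp_rw [sub_eq_add_neg]
    exact tendsto_atBot_add_const_left _ _ (tendsto_neg_atTop_atBot.comp sqrt_nat_atTop)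
  have h3 := (Real.continuous_exp.tendsto _).comp (h1.const_mul (r:ℝ))
  have := (h3.sub_const 1).add h2
  simpa using this

lemma tendsto_good (d : ℕ) (p : ℕ → ℝ) (A : (n : ℕ) → Set (FaceIdx n d → Bool)) (err : ℕ → ℝ)
    (herr : Tendsto err atTop (nhds 0))
    (h : ∀ᶠ n in atTop, YMeasure n d (p n) (A n)ᶜ ≤ ENNReal.ofReal (err n)) :
    Tendsto (fun n => YMeasure n d (p n) (A n)) atTop (nhds 1) := by
  have h1 : Tendsto (fun n => 1 - ENNReal.ofReal (err n)) atTop (nhds 1) := by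
    have := ENNReal.Tendsto.sub (tendsto_const_nhds (x := (1:ENNReal)) (f := atTop)) (ENNReal.tendsto_ofReal herr)
      (Or.inl ENNReal.one_ne_top)
    simpa using this
  refine tendsto_of_tendsto_of_tendsto_of_le_of_le' h1 tendsto_const_nhds ?_ (Eventually.of_forall fun n => prob_le_one)
  filter_upwards [h] with n hn
  rw [tsub_le_iff_right]
  calc (1:ENNReal) = YMeasure n d (p n) (A n ∪ (A n)ᶜ) := by rw [Set.union_compl_self, measure_univ]
    _ ≤ _ := measure_union_le _ _
    _ ≤ _ := by gcongr

end MW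
end

open MeasureTheory Filter Finset Matrix
noncomputable section
namespace MW

variable {n : ℕ}

lemma second_moment {Ω ι : Type} [Finite Ω] [MeasurableSpace Ω] [MeasurableSingletonClass Ω]
    (P : Measure Ω) [IsProbabilityMeasure P] (S : Finset ι) (A : ι → Set Ω) (a b : ℝ)
    (hb : 0 ≤ b) (h1 : ∀ s ∈ S, P.real (A s) = a)
    (h2 : ∀ s ∈ S, ∀ t ∈ S, s ≠ t → P.real (A s ∩ A t) ≤ b) :
    P.real {ω | ∀ s ∈ S, ω ∉ A s} * (S.card * a) ^ 2 ≤ S.card * a + S.card ^ 2 * b - (S.card * a) ^ 2 := by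
  classical
  set μ : ℝ := S.card * a with hμ
  have hm : ∀ B : Set Ω, MeasurableSet B := fun B => (Set.toFinite B).measurableSet
  have hi : ∀ f : Ω → ℝ, Integrable f P := fun f => Integrable.of_finite
  have hind : ∀ B : Set Ω, ∫ ω, B.indicator (fun _ => (1:ℝ)) ω ∂P = P.real B := fun B => by
    rw [integral_indicator (hm B)]; simp
  set Z : Set Ω := {ω | ∀ s ∈ S, ω ∉ A s} with hZ
  have hpt : ∀ ω, Z.indicator (fun _ => (1:ℝ)) ω * μ ^ 2 ≤
      (∑ s ∈ S, ∑ t ∈ S, (A s ∩ A t).indicator (fun _ => (1:ℝ)) ω) -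
        2 * μ * (∑ s ∈ S, (A s).indicator (fun _ => (1:ℝ)) ω) + μ ^ 2 := by
    intro ω
    have e : (∑ s ∈ S, ∑ t ∈ S, (A s ∩ A t).indicator (fun _ => (1:ℝ)) ω) =
        (∑ s ∈ S, (A s).indicator (fun _ => (1:ℝ)) ω) ^ 2 := by
      rw [sq, Finset.sum_mul_sum]
      refine Finset.sum_congr rfl fun s _ => Finset.sum_congr rfl fun t _ => ?_
      by_cases hs : ω ∈ A s <;> by_cases ht : ω ∈ A t <;> simp [hs, ht]
    rw [e]
    by_cases hz : ω ∈ Z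
    · have : (∑ s ∈ S, (A s).indicator (fun _ => (1:ℝ)) ω) = 0 :=
        Finset.sum_eq_zero fun s hs => Set.indicator_of_notMem (hz s hs) _
      rw [this, Set.indicator_of_mem hz]; simp
    · rw [Set.indicator_of_notMem hz]
      nlinarith [sq_nonneg ((∑ s ∈ S, (A s).indicator (fun _ => (1:ℝ)) ω) - μ)]
  have hint := integral_mono (μ := P) (hi _) (hi _) hpt
  rw [integral_mul_const, hind, integral_add (hi _) (hi _), integral_sub (hi _) (hi _),
    integral_const_mul, integral_finsetSum _ (fun _ _ => hi _),
    integral_finsetSum _ (fun _ _ => hi _)] at hint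
  simp_rw [integral_finsetSum _ (fun _ _ => hi _), hind] at hint
  rw [Finset.sum_congr rfl h1] at hint
  simp only [Finset.sum_const, nsmul_eq_mul, integral_const, probReal_univ, one_smul, smul_eq_mul,
    one_mul] at hint
  rw [← hμ] at hint
  have hs : ∑ s ∈ S, ∑ t ∈ S, P.real (A s ∩ A t) ≤ μ + S.card ^ 2 * b := by
    calc _ ≤ ∑ s ∈ S, (a + S.card * b) := by
          refine Finset.sum_le_sum fun s hs => ?_
          calc _ ≤ ∑ t ∈ S, ((if s = t then a else 0) + b) := by
                refine Finset.sum_le_sum fun t ht => ?_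
                split_ifs with h
                · subst h; rw [Set.inter_self, h1 s hs]; linarith
                · rw [zero_add]; exact h2 s hs t ht h
            _ = _ := by
                rw [Finset.sum_add_distrib, Finset.sum_ite_eq, if_pos hs]; simp
      _ = _ := by simp [hμ]; ring
  nlinarith

/-- cofaces -/
def cof (d : ℕ) (σ : Finset (Fin n)) : Finset (Finset (Fin n)) :=
  (faces n (d+1)).filter fun τ => σ ⊆ τ

lemma mem_cof (d : ℕ) (σ τ : Finset (Fin n)) : τ ∈ cof d σ ↔ τ.card = d + 1 ∧ σ ⊆ τ := by
  simp [cof, mem_faces]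

lemma card_cof (d : ℕ) (σ : Finset (Fin n)) (hσ : σ.card = d) : (cof d σ).card = n - d := by
  have : (cof d σ) = (σᶜ).image (fun v => insert v σ) := by
    ext τ
    rw [mem_cof]
    simp only [Finset.mem_image, Finset.mem_compl]
    constructor
    · rintro ⟨h1, h2⟩
      have : (τ \ σ).card = 1 := by
        rw [Finset.card_sdiff_of_subset h2]; omega
      obtain ⟨v, hv⟩ := Finset.card_eq_one.1 this
      have hv' : v ∈ τ \ σ := by rw [hv]; simp
      refine ⟨v, (Finset.mem_sdiff.1 hv').2, ?_⟩
      rw [Finset.insert_eq, ← hv, Finset.sdiff_union_of_subset h2]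
    · rintro ⟨v, hv, rfl⟩
      exact ⟨by rw [Finset.card_insert_of_notMem hv, hσ], Finset.subset_insert _ _⟩
  rw [this, Finset.card_image_of_injOn, Finset.card_compl, hσ, Fintype.card_fin]
  intro v hv u hu h
  simp only [Finset.coe_compl, Set.mem_compl_iff, Finset.mem_coe] at hv hu
  have h1 : v ∈ insert u σ := by change insert v σ = insert u σ at h; rw [← h]; exact Finset.mem_insert_self _ _
  exact (Finset.mem_insert.1 h1).resolve_right hv

lemma card_cof_inter (d : ℕ) (σ σ' : Finset (Fin n)) (hσ : σ.card = d) (hσ' : σ'.card = d)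
    (hne : σ ≠ σ') : (cof d σ ∩ cof d σ').card ≤ 1 := by
  have key : ∀ τ ∈ cof d σ ∩ cof d σ', τ = σ ∪ σ' := by
    intro τ hτ
    rw [Finset.mem_inter, mem_cof, mem_cof] at hτ
    obtain ⟨⟨h1, h2⟩, _, h3⟩ := hτ
    symm
    apply Finset.eq_of_subset_of_card_le (Finset.union_subset h2 h3)
    have : σ ⊂ σ ∪ σ' := by
      refine Finset.ssubset_iff_subset_ne.2 ⟨Finset.subset_union_left, fun h => hne ?_⟩
      have : σ' ⊆ σ := by rw [h]; exact Finset.subset_union_right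
      exact (Finset.eq_of_subset_of_card_le this (by omega)).symm
    have := Finset.card_lt_card this
    omega
  exact Finset.card_le_one.2 fun a ha b hb => (key a ha).trans (key b hb).symm

/-- isolation event -/
def iso (d : ℕ) (σ : Finset (Fin n)) : Set (FaceIdx n d → Bool) :=
  {ω | ∀ τ : FaceIdx n d, τ.1 ∈ cof d σ → ω τ = false}

lemma iso_prob (d : ℕ) (p : ℝ) (σ : Finset (Fin n)) (hσ : σ.card = d) :
    (YMeasure n d p).real (iso d σ) = (1 - cl p) ^ (n - d) := by
  have := Y_empty d p (cof d σ) (fun τ h => ((mem_cof _ _ _).1 h).1)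
  rw [card_cof d σ hσ] at this
  rw [iso, Measure.real, this, ENNReal.toReal_ofReal]
  exact pow_nonneg (by linarith [cl_le_one p]) _

lemma iso_prob2 (d : ℕ) (p : ℝ) (σ σ' : Finset (Fin n)) (hσ : σ.card = d) (hσ' : σ'.card = d)
    (hne : σ ≠ σ') :
    (YMeasure n d p).real (iso d σ ∩ iso d σ') ≤ (1 - cl p) ^ (2 * (n - d) - 1) := by
  have e : iso d σ ∩ iso d σ' = {ω | ∀ τ : FaceIdx n d, τ.1 ∈ cof d σ ∪ cof d σ' → ω τ = false} := by
    ext ω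
    simp only [iso, Set.mem_inter_iff, Set.mem_ofPred_eq, Finset.mem_union]
    constructor
    · rintro ⟨h1, h2⟩ τ (h | h)
      exacts [h1 τ h, h2 τ h]
    · intro h; exact ⟨fun τ ht => h τ (Or.inl ht), fun τ ht => h τ (Or.inr ht)⟩
  have := Y_empty d p (cof d σ ∪ cof d σ') (fun τ h => by
    rcases Finset.mem_union.1 h with h | h <;> exact ((mem_cof _ _ _).1 h).1)
  have h0 : 0 ≤ 1 - cl p := by linarith [cl_le_one p]
  rw [e, Measure.real, this, ENNReal.toReal_ofReal (pow_nonneg h0 _)]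
  apply pow_le_pow_of_le_one h0 (by linarith [cl_nonneg p])
  have := Finset.card_union_add_card_inter (cof d σ) (cof d σ')
  rw [card_cof d σ hσ, card_cof d σ' hσ'] at this
  have := card_cof_inter d σ σ' hσ hσ' hne
  omega

lemma part2_bound (d : ℕ) (hn : d < n) (p : ℝ) (hp : cl p < 1) :
    (YMeasure n d p).real {ω | ∀ σ ∈ faces n d, ω ∉ iso d σ} ≤
      1 / (n.choose d * (1 - cl p) ^ (n - d)) + cl p / (1 - cl p) := by
  have hx : 0 < 1 - cl p := by linarith
  have h := second_moment (YMeasure n d p) (faces n d) (iso d) ((1 - cl p) ^ (n - d))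
    ((1 - cl p) ^ (2 * (n - d) - 1)) (by positivity)
    (fun σ hσ => iso_prob d p σ ((mem_faces _ _).1 hσ))
    (fun σ hσ σ' hσ' => iso_prob2 d p σ σ' ((mem_faces _ _).1 hσ) ((mem_faces _ _).1 hσ'))
  rw [card_faces] at h
  have hN : (0:ℝ) < n.choose d := by exact_mod_cast Nat.choose_pos hn.le
  set x := 1 - cl p with hxd
  have hcl : cl p = 1 - x := by rw [hxd]; ring
  rw [hcl]
  set N : ℝ := (n.choose d : ℝ)
  obtain ⟨m, hm⟩ : ∃ m, n - d = m + 1 := ⟨n - d - 1, by omega⟩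
  rw [hm] at h ⊢
  have e2 : 2 * (m + 1) - 1 = 2 * m + 1 := by omega
  rw [e2] at h
  rw [← le_div_iff₀ (by positivity)] at h
  refine h.trans (le_of_eq ?_)
  field_simp
  ring

end MW
end

open MeasureTheory Filter Finset Matrix
noncomputable section
namespace MW

lemma one_sub_ge (q : ℝ) (h0 : 0 ≤ q) (h1 : q ≤ 1/2) : Real.exp (-(q + 2 * q^2)) ≤ 1 - q := by
  have h : 1 / (1 - q) ≤ Real.exp (q + 2 * q^2) := by
    have := Real.add_one_le_exp (q + 2 * q^2)
    refine le_trans ?_ this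
    rw [div_le_iff₀ (by linarith)]
    nlinarith [mul_nonneg h0 h0, mul_nonneg (mul_nonneg h0 h0) (by linarith : 0 ≤ 1/2 - q)]
  rw [Real.exp_neg]
  rw [inv_le_comm₀ (Real.exp_pos _) (by linarith)]
  simpa using h

lemma part2_event {G : Type} [AddCommGroup G] [Nontrivial G] (d : ℕ) (hd : 1 ≤ d) (w : ℕ → ℝ)
    (hw : Tendsto w atTop atTop) (p : ℕ → ℝ)
    (hp : ∀ n : ℕ, p n ≤ (d * Real.log n - w n) / n) :
    ∀ᶠ n : ℕ in atTop, YMeasure n d (p n) {ω | HomologyZero (Ycomplex n d ω) (d - 1) G} ≤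
      ENNReal.ofReal ((2 ^ d * d.factorial) * Real.exp (1 - min (w n) (Real.log n)) +
        2 * d * (Real.log n / Real.sqrt n)) := by
  have hd' : (1:ℝ) ≤ d := by exact_mod_cast hd
  have e1 := (tendsto_atTop.1 (min_atTop w hw)) 0
  have e4 : ∀ᶠ n : ℕ in atTop, Real.log n / Real.sqrt n < 1 / (2 * d) :=
    (tendsto_order.1 log_div_sqrt).2 _ (by positivity)
  filter_upwards [e1, e4, eventually_ge_atTop (2 * d + 1)] with n h1 h4 hn
  have hnd : d < n := by omega
  have hn1 : (1:ℝ) ≤ n := by exact_mod_cast (by omega : 1 ≤ n)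
  have hnpos : (0:ℝ) < n := by linarith
  set L := Real.log n with hL
  set w' := min (w n) L with hw'
  set s := Real.sqrt n with hs
  have hss : s * s = n := Real.mul_self_sqrt hnpos.le
  have hs1 : 1 ≤ s := Real.one_le_sqrt.2 hn1
  have hL0 : 0 ≤ L := Real.log_nonneg hn1
  have hw'L : w' ≤ L := min_le_right _ _
  set q := (d * L - w') / n with hq
  have hq0 : 0 ≤ q := div_nonneg (by nlinarith) hnpos.le
  have hqn : n * q = d * L - w' := by rw [hq]; field_simp
  have hLs : 0 ≤ L / s := by positivity
  have hns : d * L / n = d * (L / s) / s := by rw [← hss]; field_simp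
  have hqd : q ≤ d * (L / s) / s := by
    rw [← hns, hq]; gcongr; linarith
  have hdLs : d * (L / s) ≤ 1/2 := by
    have : d * (L / s) ≤ d * (1 / (2 * d)) := by gcongr
    have e : (d:ℝ) * (1 / (2 * d)) = 1/2 := by field_simp
    linarith
  have hqd' : q ≤ d * (L / s) := hqd.trans (div_le_self (by positivity) hs1)
  have hqh : q ≤ 1/2 := by linarith
  have hnq2 : n * (2 * q^2) ≤ 1 := by
    have a : q * s ≤ 1/2 := by
      have := (le_div_iff₀ (by linarith)).1 hqd
      linarith
    have b : 0 ≤ q * s := by positivity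
    have : n * (2 * q^2) = 2 * (q * s)^2 := by rw [← hss]; ring
    rw [this]; nlinarith
  have hcl : cl (p n) ≤ q := by
    refine max_le hq0 ((min_le_left _ _).trans ((hp n).trans ?_))
    rw [hq]; gcongr; exact min_le_left _ _
  have hb := part2_bound d hnd (p n) (by linarith)
  have hsub : {ω : FaceIdx n d → Bool | HomologyZero (Ycomplex n d ω) (d - 1) G} ⊆
      {ω | ∀ σ ∈ faces n d, ω ∉ iso d σ} := by
    intro ω hω σ hσ hi
    have hc := (mem_faces _ _).1 hσ
    exact isolated_obstructs (G := G) d hd hnd ω σ hc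
      (fun τ ht => hi τ ((mem_cof _ _ _).2 ⟨τ.2, ht⟩)) hω
  refine (measure_mono hsub).trans ?_
  rw [← ENNReal.ofReal_toReal (measure_ne_top (YMeasure n d (p n)) _)]
  refine ENNReal.ofReal_le_ofReal (hb.trans (add_le_add ?_ ?_))
  · have hx : Real.exp (-(d * L) + w' - 1) ≤ (1 - cl (p n)) ^ (n - d) := by
      calc Real.exp (-(d * L) + w' - 1) ≤ Real.exp (n * (-(q + 2 * q^2))) := by
            apply Real.exp_le_exp.2
            have : n * (-(q + 2 * q^2)) = -(n * q) - n * (2 * q^2) := by ring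
            rw [this, hqn]; linarith
        _ = Real.exp (-(q + 2 * q^2)) ^ n := by rw [Real.exp_nat_mul]
        _ ≤ (1 - q) ^ n := by
            gcongr; exact one_sub_ge q hq0 hqh
        _ ≤ (1 - cl (p n)) ^ n := by
            apply pow_le_pow_left₀ <;> linarith
        _ ≤ _ := pow_le_pow_of_le_one (by linarith) (by linarith [cl_nonneg (p n)]) (Nat.sub_le _ _)
    have hN : (n:ℝ)^d / (2^d * d.factorial) ≤ n.choose d := by
      refine le_trans ?_ (Nat.pow_le_choose (α := ℝ) d n)
      rw [← div_div, ← div_pow]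
      gcongr
      rw [Nat.cast_sub (by omega)]
      have : (2:ℝ) * d + 1 ≤ n := by exact_mod_cast hn
      push_cast; linarith
    have hpw : (n:ℝ)^d = Real.exp (d * L) := by
      rw [Real.exp_nat_mul, hL, Real.exp_log hnpos]
    have hm : Real.exp (w' - 1) / (2^d * d.factorial) ≤ n.choose d * (1 - cl (p n)) ^ (n - d) := by
      calc Real.exp (w' - 1) / (2^d * d.factorial)
          = (n:ℝ)^d / (2^d * d.factorial) * Real.exp (-(d * L) + w' - 1) := by
            rw [hpw, div_mul_eq_mul_div, ← Real.exp_add]; congr 2; ring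
        _ ≤ _ := by gcongr
    have hfp : (0:ℝ) < 2^d * d.factorial := by positivity
    calc _ ≤ 1 / (Real.exp (w' - 1) / (2^d * d.factorial)) :=
          one_div_le_one_div_of_le (by positivity) hm
      _ = _ := by
        rw [one_div_div, div_eq_mul_inv, ← Real.exp_neg]; congr 2; ring
  · rw [div_le_iff₀ (by linarith)]
    have : 0 ≤ 2 * d * (L / s) := by positivity
    nlinarith [mul_le_mul_of_nonneg_left (by linarith : (1:ℝ)/2 ≤ 1 - cl (p n)) this]

lemma part2_err (C D : ℝ) (w : ℕ → ℝ) (hw : Tendsto w atTop atTop) :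
    Tendsto (fun n : ℕ => C * Real.exp (1 - min (w n) (Real.log n)) +
        D * (Real.log n / Real.sqrt n)) atTop (nhds 0) := by
  have h1 : Tendsto (fun n : ℕ => Real.exp (1 - min (w n) (Real.log n))) atTop (nhds 0) := by
    refine Real.tendsto_exp_atBot.comp ?_
    simp_rw [sub_eq_add_neg]
    exact tendsto_atBot_add_const_left _ _ (tendsto_neg_atTop_atBot.comp (min_atTop w hw))
  simpa using (h1.const_mul C).add (log_div_sqrt.const_mul D)

end MW
end

noncomputable section
/-- **The Meshulam–Wallach theorem.** Fix `d ≥ 1` and a nontrivial finite abelian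
group `G`. If `p ≥ (d log n + ω(n))/n` then w.h.p. `H_{d−1}(Y_d(n,p), G) = 0`
(reduced homology when `d = 1`), and if `p ≤ (d log n − ω(n))/n` then w.h.p.
`H_{d−1}(Y_d(n,p), G) ≠ 0`. -/
theorem meshulam_wallach (d : ℕ) (hd : 1 ≤ d)
    (G : Type) [AddCommGroup G] [Fintype G] [Nontrivial G]
    (w : ℕ → ℝ) (hw : Tendsto w atTop atTop) (p : ℕ → ℝ) :
    ((∀ n : ℕ, (d * Real.log n + w n) / n ≤ p n) →
      Tendsto (fun n : ℕ => YMeasure n d (p n)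
          {ω | HomologyZero (Ycomplex n d ω) (d - 1) G})
        atTop (nhds (1 : ENNReal))) ∧
    ((∀ n : ℕ, p n ≤ (d * Real.log n - w n) / n) →
      Tendsto (fun n : ℕ => YMeasure n d (p n)
          {ω | ¬ HomologyZero (Ycomplex n d ω) (d - 1) G})
        atTop (nhds (1 : ENNReal))) := by

  constructor
  · intro hp
    exact MW.tendsto_good d p _ _ (MW.part1_err (Nat.card (G →+ AddCircle (1:ℚ))) w hw)
      (MW.part1_event d hd w hw p hp)
  · intro hp
    refine MW.tendsto_good d p _ _ (MW.part2_err (2 ^ d * d.factorial) (2 * d) w hw) ?_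
    filter_upwards [MW.part2_event (G := G) d hd w hw p hp] with n hn
    refine le_trans (measure_mono ?_) hn
    intro ω hω
    by_contra h
    exact hω h
end
end
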